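/- arXiv:1407.0480 — 3 statements merged into one kernel-verified Lean document; each statement's English description precedes it below -/
import Mathlib

section
/- Let F be an algebraically closed field of characteristic 0, K/F a field extension with K algebraically closed, A a finite-dimensional nonassociative F-algebra, and G a finitely generated abelian group. Then every G-grading on A_K = A ⊗_F K is isomorphic to Γ_K for some G-grading Γ on A; that is, for every G-grading Δ : A_K = ⊕_{g∈G} B_g there exist a G-grading Γ : A = ⊕_{g∈G} A_g and a K-algebra automorphism φ of A_K with φ(A_g ⊗_F K) = B_g for all g ∈ G. -/
open scoped TensorProduct

universe u

section GradingDefs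

variable {F : Type*} [Field F] {A : Type*} [NonUnitalNonAssocSemiring A] [Module F A]

/-- The family `comp` of `F`-subspaces is a grading of the nonassociative `F`-algebra `A`
by the abelian group `G`: `A` is the (internal) direct sum of the subspaces `comp g`, and
`comp g * comp h ⊆ comp (g * h)`. -/
def IsGrading {G : Type*} [CommGroup G] (comp : G → Submodule F A) : Prop :=
  iSupIndep comp ∧ (⨆ g, comp g) = ⊤ ∧
    ∀ (g h : G) (a b : A), a ∈ comp g → b ∈ comp h → a * b ∈ comp (g * h)

/-- The support of a grading: those degrees with nonzero homogeneous component. -/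
def gradingSupp {G : Type*} [CommGroup G] (comp : G → Submodule F A) : Set G :=
  {g | comp g ≠ ⊥}

/-- A linear automorphism of `A` is an algebra automorphism if it preserves multiplication. -/
def IsAlgAut (φ : A ≃ₗ[F] A) : Prop := ∀ a b : A, φ (a * b) = φ a * φ b

/-- Two `G`-gradings are isomorphic if some algebra automorphism maps each homogeneous
component of the first onto the component of the same degree of the second. -/
def GradingIso {G : Type*} [CommGroup G] (comp comp' : G → Submodule F A) : Prop :=
  ∃ φ : A ≃ₗ[F] A, IsAlgAut φ ∧
    ∀ g, (comp g).map (φ : A →ₗ[F] A) = comp' g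

/-- A `G`-grading and an `H`-grading are equivalent if there are a bijection `α` between the
supports and an algebra automorphism `φ` with `φ (comp g) = comp' (α g)` on the support. -/
def GradingEquiv {G : Type*} [CommGroup G] {H : Type*} [CommGroup H]
    (comp : G → Submodule F A) (comp' : H → Submodule F A) : Prop :=
  ∃ (α : G → H) (φ : A ≃ₗ[F] A), IsAlgAut φ ∧
    Set.BijOn α (gradingSupp comp) (gradingSupp comp') ∧
    ∀ g ∈ gradingSupp comp, (comp g).map (φ : A →ₗ[F] A) = comp' (α g)

/-- An `H`-indexed family `comp'` refines a `G`-indexed family `comp` if every nonzero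
component of `comp'` is contained in some nonzero component of `comp`. -/
def IsRefinement {H : Type*} [CommGroup H] {G : Type*} [CommGroup G]
    (comp' : H → Submodule F A) (comp : G → Submodule F A) : Prop :=
  ∀ h ∈ gradingSupp comp', ∃ g ∈ gradingSupp comp, comp' h ≤ comp g

/-- A refinement is proper if some containment of a nonzero component of the refinement in a
component of the coarser grading is strict. -/
def IsProperRefinement {H : Type*} [CommGroup H] {G : Type*} [CommGroup G]
    (comp' : H → Submodule F A) (comp : G → Submodule F A) : Prop :=
  IsRefinement comp' comp ∧
    ∃ h ∈ gradingSupp comp', ∃ g ∈ gradingSupp comp, comp' h < comp g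

/-- A grading is fine if it admits no proper refinement which is itself a grading by an
abelian group. -/
def IsFine {G : Type*} [CommGroup G] (comp : G → Submodule F A) : Prop :=
  ∀ (H : Type u) (_ : CommGroup H) (comp' : H → Submodule F A),
    IsGrading comp' → ¬ IsProperRefinement comp' comp

end GradingDefs

section StructureConstants

variable {F ι G : Type*} [Field F] [Fintype ι]

/-- The bilinear multiplication on `ι → T` with structure constants `c`. -/
noncomputable def structMul (c : ι → ι → ι → F) (T : Type*) [CommRing T] [Algebra F T] :
    (ι → T) →ₗ[T] (ι → T) →ₗ[T] (ι → T) :=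
  LinearMap.mk₂ T (fun x y k => ∑ i, ∑ j, algebraMap F T (c i j k) * (x i * y j))
    (fun x x' y => by ext k; simp [add_mul, mul_add, Finset.sum_add_distrib])
    (fun a x y => by ext k; simp [Finset.mul_sum, mul_left_comm, mul_assoc])
    (fun x y y' => by ext k; simp [mul_add, Finset.sum_add_distrib])
    (fun a x y => by ext k; simp [Finset.mul_sum, mul_left_comm])

/-- Grading of `(ι → T, structMul c T)` given by the matrices of the projections onto the
homogeneous components, with support contained in `S`. -/
structure IsMatGrading [DecidableEq ι] [CommGroup G] (c : ι → ι → ι → F) {T : Type*}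
    [CommRing T] [Algebra F T] (S : Finset G) (π : G → Matrix ι ι T) : Prop where
  eq_zero : ∀ g ∉ S, π g = 0
  mul_of_ne : ∀ g h, g ≠ h → π g * π h = 0
  mul_self : ∀ g, π g * π g = π g
  sum_eq : ∑ g ∈ S, π g = 1
  mul_mem : ∀ g h x y, (π (g * h)).mulVec (structMul c T ((π g).mulVec x) ((π h).mulVec y)) =
    structMul c T ((π g).mulVec x) ((π h).mulVec y)

/-- `φ` and `ψ` are inverse automorphisms of `(ι → T, structMul c T)`, and `φ` maps the grading
`p` onto the grading `π`. -/
structure IsMatIso [DecidableEq ι] (c : ι → ι → ι → F) {T : Type*} [CommRing T] [Algebra F T]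
    (p π : G → Matrix ι ι T) (φ ψ : Matrix ι ι T) : Prop where
  mul_inv : φ * ψ = 1
  inv_mul : ψ * φ = 1
  map_mul : ∀ x y, φ.mulVec (structMul c T x y) = structMul c T (φ.mulVec x) (φ.mulVec y)
  comm : ∀ g, φ * p g = π g * φ

/-- `D` is a derivation of `(ι → T, structMul c T)`. -/
def IsMatDer (c : ι → ι → ι → F) {T : Type*} [CommRing T] [Algebra F T] (D : Matrix ι ι T) : Prop :=
  ∀ x y, D.mulVec (structMul c T x y) =
    structMul c T (D.mulVec x) y + structMul c T x (D.mulVec y)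

variable {c : ι → ι → ι → F} {T T' : Type*} [CommRing T] [Algebra F T] [CommRing T'] [Algebra F T']

lemma structMul_apply (x y : ι → T) (k : ι) :
    structMul c T x y k = ∑ i, ∑ j, algebraMap F T (c i j k) * (x i * y j) := rfl

lemma comp_structMul (f : T →ₐ[F] T') (x y : ι → T) :
    f ∘ structMul c T x y = structMul c T' (f ∘ x) (f ∘ y) := by
  ext k; simp [structMul_apply]

lemma comp_mulVec (f : T →ₐ[F] T') (M : Matrix ι ι T) (x : ι → T) :
    f ∘ M.mulVec x = (M.map f).mulVec (f ∘ x) :=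
  funext fun i => RingHom.map_mulVec (f : T →+* T') M x i

variable [DecidableEq ι]

omit [Fintype ι] in
lemma comp_single_one (f : T →ₐ[F] T') (i : ι) :
    f ∘ Pi.single i 1 = (Pi.single i 1 : ι → T') := by
  ext k; simp [Pi.single_apply, apply_ite f]

lemma bilin_ext {B B' : (ι → T) →ₗ[T] (ι → T) →ₗ[T] (ι → T)}
    (h : ∀ i j, B (Pi.single i 1) (Pi.single j 1) = B' (Pi.single i 1) (Pi.single j 1))
    (x y : ι → T) : B x y = B' x y := by
  have : B = B' := LinearMap.ext_basis (Pi.basisFun T ι) (Pi.basisFun T ι) (by simpa using h)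
  rw [this]

lemma IsMatGrading.map [CommGroup G] {S : Finset G} {π : G → Matrix ι ι T} (h : IsMatGrading c S π)
    (f : T →ₐ[F] T') : IsMatGrading c S (fun g => (π g).map f) where
  eq_zero g hg := by simp [h.eq_zero g hg]
  mul_of_ne g g' hg := by rw [← Matrix.map_mul, h.mul_of_ne g g' hg]; simp
  mul_self g := by rw [← Matrix.map_mul, h.mul_self g]
  sum_eq := by
    have := congrArg f.mapMatrix h.sum_eq
    simpa [map_sum] using this
  mul_mem g g' x y := by
    refine bilin_ext
      (B := ((structMul c T').compl₁₂ ((π g).map f).mulVecLin ((π g').map f).mulVecLin).compr₂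
        ((π (g * g')).map f).mulVecLin)
      (B' := (structMul c T').compl₁₂ ((π g).map f).mulVecLin ((π g').map f).mulVecLin)
      (fun i j => ?_) x y
    have := congrArg (f ∘ ·) (h.mul_mem g g' (Pi.single i 1) (Pi.single j 1))
    simp only [comp_mulVec, comp_structMul, comp_single_one] at this
    simpa only [LinearMap.compr₂_apply, LinearMap.compl₁₂_apply, Matrix.mulVecLin_apply] using this

lemma IsMatGrading.of_map [CommGroup G] {S : Finset G} {π : G → Matrix ι ι T} (f : T →ₐ[F] T')
    (hf : Function.Injective f) (h : IsMatGrading c S (fun g => (π g).map f)) :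
    IsMatGrading c S π where
  eq_zero g hg := Matrix.map_injective hf (by simpa using h.eq_zero g hg)
  mul_of_ne g g' hg := Matrix.map_injective hf (by simpa [Matrix.map_mul] using h.mul_of_ne g g' hg)
  mul_self g := Matrix.map_injective hf (by simpa [Matrix.map_mul] using h.mul_self g)
  sum_eq := by
    have hinj : Function.Injective (f.mapMatrix (m := ι)) := Matrix.map_injective hf
    refine hinj ?_
    simpa [map_sum] using h.sum_eq
  mul_mem g g' x y := by
    refine hf.comp_left ?_
    simpa only [comp_mulVec, comp_structMul] using h.mul_mem g g' (f ∘ x) (f ∘ y)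

lemma IsMatIso.map {p π : G → Matrix ι ι T} {φ ψ : Matrix ι ι T} (h : IsMatIso c p π φ ψ)
    (f : T →ₐ[F] T') :
    IsMatIso c (fun g => (p g).map f) (fun g => (π g).map f) (φ.map f) (ψ.map f) where
  mul_inv := by rw [← Matrix.map_mul, h.mul_inv]; simp
  inv_mul := by rw [← Matrix.map_mul, h.inv_mul]; simp
  comm g := by rw [← Matrix.map_mul, h.comm g, Matrix.map_mul]
  map_mul x y := by
    refine bilin_ext (B := (structMul c T').compr₂ (φ.map f).mulVecLin)
      (B' := (structMul c T').compl₁₂ (φ.map f).mulVecLin (φ.map f).mulVecLin)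
      (fun i j => ?_) x y
    have := congrArg (f ∘ ·) (h.map_mul (Pi.single i 1) (Pi.single j 1))
    simp only [comp_mulVec, comp_structMul, comp_single_one] at this
    simpa only [LinearMap.compr₂_apply, LinearMap.compl₁₂_apply, Matrix.mulVecLin_apply] using this

lemma IsMatIso.of_map {p π : G → Matrix ι ι T} {φ ψ : Matrix ι ι T} (f : T →ₐ[F] T')
    (hf : Function.Injective f)
    (h : IsMatIso c (fun g => (p g).map f) (fun g => (π g).map f) (φ.map f) (ψ.map f)) :
    IsMatIso c p π φ ψ where
  mul_inv := Matrix.map_injective hf (by simpa [Matrix.map_mul] using h.mul_inv)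
  inv_mul := Matrix.map_injective hf (by simpa [Matrix.map_mul] using h.inv_mul)
  comm g := Matrix.map_injective hf (by simpa [Matrix.map_mul] using h.comm g)
  map_mul x y := by
    refine hf.comp_left ?_
    simpa only [comp_mulVec, comp_structMul] using h.map_mul (f ∘ x) (f ∘ y)

lemma IsMatIso.trans {p π ρ : G → Matrix ι ι T} {φ ψ φ' ψ' : Matrix ι ι T}
    (h : IsMatIso c p π φ ψ) (h' : IsMatIso c π ρ φ' ψ') :
    IsMatIso c p ρ (φ' * φ) (ψ * ψ') where
  mul_inv := by rw [mul_assoc, ← mul_assoc φ, h.mul_inv, one_mul, h'.mul_inv]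
  inv_mul := by rw [mul_assoc, ← mul_assoc ψ', h'.inv_mul, one_mul, h.inv_mul]
  comm g := by rw [mul_assoc, h.comm, ← mul_assoc, h'.comm, mul_assoc]
  map_mul x y := by simp only [← Matrix.mulVec_mulVec, h.map_mul, h'.map_mul]

lemma IsMatIso.refl (p : G → Matrix ι ι T) : IsMatIso c p p 1 1 where
  mul_inv := mul_one 1
  inv_mul := mul_one 1
  comm g := by simp
  map_mul x y := by simp

/-- Transport of a grading along an automorphism. -/
lemma IsMatGrading.conj [CommGroup G] {S : Finset G} {π : G → Matrix ι ι T} (h : IsMatGrading c S π)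
    {φ ψ : Matrix ι ι T} (hφψ : φ * ψ = 1) (hψφ : ψ * φ = 1)
    (hφ : ∀ x y, φ.mulVec (structMul c T x y) = structMul c T (φ.mulVec x) (φ.mulVec y)) :
    IsMatGrading c S (fun g => ψ * π g * φ) := by
  have hmul (A B : Matrix ι ι T) : ψ * A * φ * (ψ * B * φ) = ψ * (A * B) * φ := by
    calc _ = ψ * A * (φ * ψ) * B * φ := by simp only [mul_assoc]
      _ = _ := by rw [hφψ, mul_one]; simp only [mul_assoc]
  have hψ (x y) : ψ.mulVec (structMul c T x y) = structMul c T (ψ.mulVec x) (ψ.mulVec y) := by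
    have := hφ (ψ.mulVec x) (ψ.mulVec y)
    simp only [Matrix.mulVec_mulVec, hφψ, Matrix.one_mulVec] at this
    rw [← this, Matrix.mulVec_mulVec, hψφ, Matrix.one_mulVec]
  exact
  { eq_zero g hg := by simp [h.eq_zero g hg]
    mul_of_ne g g' hg := by rw [hmul, h.mul_of_ne g g' hg]; simp
    mul_self g := by rw [hmul, h.mul_self g]
    sum_eq := by rw [← Finset.sum_mul, ← Finset.mul_sum, h.sum_eq, mul_one, hψφ]
    mul_mem g g' x y := by
      simp only [← Matrix.mulVec_mulVec, ← hψ]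
      rw [Matrix.mulVec_mulVec _ φ ψ, hφψ, Matrix.one_mulVec, h.mul_mem] }

lemma isMatDer_iff {D : Matrix ι ι T} : IsMatDer c D ↔
    ∀ i j k, ∑ l, c i j l • D k l = (∑ l, c l j k • D l i) + ∑ l, c i l k • D l j := by
  have key (i j : ι) : D.mulVec (structMul c T (Pi.single i 1) (Pi.single j 1)) =
      structMul c T (D.mulVec (Pi.single i 1)) (Pi.single j 1) +
        structMul c T (Pi.single i 1) (D.mulVec (Pi.single j 1)) ↔
      ∀ k, ∑ l, c i j l • D k l = (∑ l, c l j k • D l i) + ∑ l, c i l k • D l j := by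
    rw [funext_iff]
    refine forall_congr' fun k => ?_
    simp [Matrix.mulVec, dotProduct, structMul_apply, Pi.single_apply, Algebra.smul_def, mul_comm]
  constructor
  · intro h i j
    exact (key i j).1 (h _ _)
  · intro h x y
    exact bilin_ext (B := (structMul c T).compr₂ D.mulVecLin)
      (B' := (structMul c T).compl₁₂ D.mulVecLin .id + (structMul c T).compl₁₂ .id D.mulVecLin)
      (fun i j => (key i j).2 (h i j)) x y

lemma IsMatDer.map {D : Matrix ι ι T} (h : IsMatDer c D) (s : T →ₗ[F] T') :
    IsMatDer c (D.map s) := by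
  rw [isMatDer_iff] at h ⊢
  intro i j k
  simpa using congrArg s (h i j k)

/-- The algebra on `ι → T` with structure constants `c`. -/
def StructAlg (_ : ι → ι → ι → F) (T : Type*) : Type _ := ι → T

namespace StructAlg

instance : AddCommGroup (StructAlg c T) := inferInstanceAs (AddCommGroup (ι → T))

instance : Module T (StructAlg c T) := inferInstanceAs (Module T (ι → T))

instance [Algebra ℚ T] : Module ℚ (StructAlg c T) := inferInstanceAs (Module ℚ (ι → T))

noncomputable instance : NonUnitalNonAssocRing (StructAlg c T) where
  mul x y := structMul c T x y
  left_distrib x y z := map_add (structMul c T x) y z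
  right_distrib x y z := LinearMap.map_add₂ (structMul c T) x y z
  zero_mul x := LinearMap.map_zero₂ (structMul c T) x
  mul_zero x := map_zero (structMul c T x)

instance : SMulCommClass T (StructAlg c T) (StructAlg c T) :=
  ⟨fun a x y => (map_smul (structMul c T x) a y).symm⟩

instance : IsScalarTower T (StructAlg c T) (StructAlg c T) :=
  ⟨fun a x y => LinearMap.map_smul₂ (structMul c T) a x y⟩

end StructAlg

lemma IsMatDer.exp_map_mul [Algebra ℚ T] {D : Matrix ι ι T} (h : IsMatDer c D) (hn : IsNilpotent D)
    (x y : ι → T) : (IsNilpotent.exp D).mulVec (structMul c T x y) =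
      structMul c T ((IsNilpotent.exp D).mulVec x) ((IsNilpotent.exp D).mulVec y) := by
  let e : Matrix ι ι T ≃ₐ[T] Module.End T (StructAlg c T) := Matrix.toLinAlgEquiv'
  have hexp : e (IsNilpotent.exp D) = IsNilpotent.exp (e D) := IsNilpotent.map_exp hn e
  have := Module.End.exp_mul_of_derivation T (StructAlg c T) (e D)
    (fun x y => (h x y).trans (add_comm _ _)) (hn.map e) x y
  rw [← hexp] at this
  exact this

lemma IsMatGrading.sum_mulVec [CommGroup G] {S : Finset G} {p : G → Matrix ι ι T}
    (h : IsMatGrading c S p) (x : ι → T) : ∑ g ∈ S, (p g).mulVec x = x := by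
  rw [← Matrix.sum_mulVec, h.sum_eq, Matrix.one_mulVec]

lemma IsMatGrading.sum_eq_single [CommGroup G] {S : Finset G} {p : G → Matrix ι ι T}
    (h : IsMatGrading c S p) {M : Type*} [AddCommMonoid M] {f : G → M} (g : G)
    (hne : ∀ g', g' ≠ g → f g' = 0) (hp : p g = 0 → f g = 0) : ∑ g' ∈ S, f g' = f g :=
  Finset.sum_eq_single g (fun g' _ hg => hne g' hg) (fun hg => hp (h.eq_zero g hg))

lemma IsMatGrading.proj_mul_right [CommGroup G] {S : Finset G} {p : G → Matrix ι ι T}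
    (h : IsMatGrading c S p) (g g' : G) (z y : ι → T) :
    (p (g * g')).mulVec (structMul c T z ((p g').mulVec y)) =
      structMul c T ((p g).mulVec z) ((p g').mulVec y) := by
  conv_lhs => rw [← h.sum_mulVec z]
  rw [map_sum, LinearMap.sum_apply, Matrix.mulVec_sum,
    h.sum_eq_single g (fun g'' hg => ?_) (fun hg => ?_), h.mul_mem]
  · rw [← h.mul_mem, Matrix.mulVec_mulVec, h.mul_of_ne _ _ (by simpa using hg.symm),
      Matrix.zero_mulVec]
  · simp [hg]

lemma IsMatGrading.proj_mul_left [CommGroup G] {S : Finset G} {p : G → Matrix ι ι T}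
    (h : IsMatGrading c S p) (g g' : G) (x z : ι → T) :
    (p (g * g')).mulVec (structMul c T ((p g).mulVec x) z) =
      structMul c T ((p g).mulVec x) ((p g').mulVec z) := by
  conv_lhs => rw [← h.sum_mulVec z]
  rw [map_sum, Matrix.mulVec_sum,
    h.sum_eq_single g' (fun g'' hg => ?_) (fun hg => ?_), h.mul_mem]
  · rw [← h.mul_mem, Matrix.mulVec_mulVec, h.mul_of_ne _ _ (by simpa using hg.symm),
      Matrix.zero_mulVec]
  · simp [hg]

lemma IsMatGrading.sum_mul_proj [CommGroup G] {S : Finset G} {p : G → Matrix ι ι T}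
    (h : IsMatGrading c S p) (π : G → Matrix ι ι T) (g : G) :
    (∑ g' ∈ S, π g' * p g') * p g = π g * p g := by
  rw [Finset.sum_mul, h.sum_eq_single g (fun g' hg => ?_) (fun hg => ?_), mul_assoc, h.mul_self]
  · rw [mul_assoc, h.mul_of_ne _ _ hg, mul_zero]
  · simp [hg]

lemma IsMatGrading.proj_mul_sum [CommGroup G] {S : Finset G} {π : G → Matrix ι ι T}
    (h : IsMatGrading c S π) (p : G → Matrix ι ι T) (g : G) :
    π g * (∑ g' ∈ S, π g' * p g') = π g * p g := by
  rw [Finset.mul_sum, h.sum_eq_single g (fun g' hg => ?_) (fun hg => ?_), ← mul_assoc, h.mul_self]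
  · rw [← mul_assoc, h.mul_of_ne _ _ hg.symm, zero_mul]
  · simp [hg]

lemma sum_mul_sub_one_mem [CommGroup G] {S : Finset G} {π p : G → Matrix ι ι T}
    (hp : IsMatGrading c S p) {J : Ideal T} (hJ : ∀ g i j, π g i j - p g i j ∈ J) (i j : ι) :
    (∑ g ∈ S, π g * p g - 1) i j ∈ J := by
  have : ∑ g ∈ S, π g * p g - 1 = ∑ g ∈ S, (π g - p g) * p g := by
    simp only [sub_mul, Finset.sum_sub_distrib, hp.mul_self, hp.sum_eq]
  rw [this, Matrix.sum_apply]
  exact J.sum_mem fun g _ => J.sum_mem fun l _ => J.mul_mem_right _ (hJ g i l)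

omit [DecidableEq ι] in
lemma structMul_mem_left {J : Ideal T} {u : ι → T} (hu : ∀ i, u i ∈ J) (y : ι → T) (k : ι) :
    structMul c T u y k ∈ J :=
  J.sum_mem fun i _ => J.sum_mem fun _ _ => J.mul_mem_left _ (J.mul_mem_right _ (hu i))

omit [DecidableEq ι] in
lemma structMul_mem_right {J : Ideal T} {v : ι → T} (hv : ∀ i, v i ∈ J) (x : ι → T) (k : ι) :
    structMul c T x v k ∈ J :=
  J.sum_mem fun _ _ => J.sum_mem fun j _ => J.mul_mem_left _ (J.mul_mem_left _ (hv j))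

/-- Two gradings agreeing modulo a square-zero ideal differ by a derivation. -/
lemma isMatDer_sum_mul_sub_one [CommGroup G] {S : Finset G} {π p : G → Matrix ι ι T}
    (hπ : IsMatGrading c S π) (hp : IsMatGrading c S p) {J : Ideal T}
    (hJJ : ∀ a ∈ J, ∀ b ∈ J, a * b = 0) (hJ : ∀ g i j, π g i j - p g i j ∈ J) :
    IsMatDer c (∑ g ∈ S, π g * p g - 1) := by
  set D := ∑ g ∈ S, π g * p g - 1 with hD
  have hDmem : ∀ i j, D i j ∈ J := sum_mul_sub_one_mem hp hJ
  have hproj (g : G) {u : ι → T} (hu : ∀ i, u i ∈ J) : (p g).mulVec u = (π g).mulVec u := by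
    ext i
    rw [← sub_eq_zero, Matrix.mulVec, Matrix.mulVec, dotProduct, dotProduct,
      ← Finset.sum_sub_distrib]
    refine Finset.sum_eq_zero fun l _ => ?_
    rw [← sub_mul, ← neg_sub, neg_mul, hJJ _ (hJ g i l) _ (hu l), neg_zero]
  have hDp (g : G) (x : ι → T) :
      D.mulVec ((p g).mulVec x) = (π g).mulVec ((p g).mulVec x) - (p g).mulVec x := by
    rw [Matrix.mulVec_mulVec, hD, sub_mul, hp.sum_mul_proj, one_mul, Matrix.sub_mulVec,
      Matrix.mulVec_mulVec]
  have hDa (x : ι → T) (i : ι) : D.mulVec x i ∈ J :=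
    J.sum_mem fun l _ => J.mul_mem_right _ (hDmem i l)
  have hker (g : G) (x : ι → T) : (p g).mulVec (D.mulVec ((p g).mulVec x)) = 0 := by
    rw [hproj g (hDa _), hDp, Matrix.mulVec_sub, Matrix.mulVec_mulVec _ (π g) (π g), hπ.mul_self,
      sub_self]
  have hom (g h : G) (x y : ι → T) :
      D.mulVec (structMul c T ((p g).mulVec x) ((p h).mulVec y)) =
        structMul c T (D.mulVec ((p g).mulVec x)) ((p h).mulVec y) +
          structMul c T ((p g).mulVec x) (D.mulVec ((p h).mulVec y)) := by
    have hu : (π (g * h)).mulVec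
        (structMul c T (D.mulVec ((p g).mulVec x)) ((p h).mulVec y)) = 0 := by
      rw [← hproj _ (structMul_mem_left (hDa _) _), hp.proj_mul_right, hker, map_zero,
        LinearMap.zero_apply]
    have hv : (π (g * h)).mulVec
        (structMul c T ((p g).mulVec x) (D.mulVec ((p h).mulVec y))) = 0 := by
      rw [← hproj _ (structMul_mem_right (hDa _) _), hp.proj_mul_left, hker, map_zero]
    have huv : structMul c T (D.mulVec ((p g).mulVec x)) (D.mulVec ((p h).mulVec y)) = 0 := by
      ext k
      rw [structMul_apply]
      refine Finset.sum_eq_zero fun i _ => Finset.sum_eq_zero fun j _ => ?_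
      rw [hJJ _ (hDa _ i) _ (hDa _ j), mul_zero]
    have hg : (π g).mulVec ((p g).mulVec x) = (p g).mulVec x + D.mulVec ((p g).mulVec x) := by
      rw [hDp]; abel
    have hh : (π h).mulVec ((p h).mulVec y) = (p h).mulVec y + D.mulVec ((p h).mulVec y) := by
      rw [hDp]; abel
    have key := hπ.mul_mem g h ((p g).mulVec x) ((p h).mulVec y)
    simp only [hg, hh, map_add, LinearMap.add_apply, huv, add_zero, Matrix.mulVec_add, hu, hv]
      at key
    have hgh := hDp (g * h) (structMul c T ((p g).mulVec x) ((p h).mulVec y))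
    rw [hp.mul_mem, key] at hgh
    rw [hgh]; abel
  intro x y
  conv_lhs => rw [← hp.sum_mulVec x, ← hp.sum_mulVec y]
  conv_rhs => rw [← hp.sum_mulVec x, ← hp.sum_mulVec y]
  simp only [map_sum, LinearMap.sum_apply, Matrix.mulVec_sum, hom, Finset.sum_add_distrib]

lemma pow_apply_mem {I : Ideal T} {D : Matrix ι ι T} (hD : ∀ i j, D i j ∈ I) (n : ℕ) (i j : ι) :
    (D ^ n) i j ∈ I ^ n := by
  induction n generalizing i j with
  | zero => simp
  | succ n ih =>
    rw [pow_succ, pow_succ, Matrix.mul_apply]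
    exact Ideal.sum_mem _ fun l _ => Ideal.mul_mem_mul (ih i l) (hD l j)

/-- Improving an approximate isomorphism of gradings by one order. -/
lemma exists_aut_conj_sub_mem [CommGroup G] [Algebra ℚ T] {S : Finset G} {I : Ideal T} {N : ℕ}
    (hN : I ^ N = ⊥) {k : ℕ} (hk : 1 ≤ k) {π p : G → Matrix ι ι T} (hπ : IsMatGrading c S π)
    (hp : IsMatGrading c S p) (h : ∀ g i j, π g i j - p g i j ∈ I ^ k) :
    ∃ φ ψ : Matrix ι ι T, φ * ψ = 1 ∧ ψ * φ = 1 ∧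
      (∀ x y, φ.mulVec (structMul c T x y) = structMul c T (φ.mulVec x) (φ.mulVec y)) ∧
      ∀ g i j, (ψ * π g * φ) i j - p g i j ∈ I ^ (k + 1) := by
  let q : T →ₐ[F] T ⧸ I ^ (k + 1) := Ideal.Quotient.mkₐ F (I ^ (k + 1))
  have hq : Function.Surjective q := Ideal.Quotient.mkₐ_surjective F _
  have hq0 (a : T) : q a = 0 ↔ a ∈ I ^ (k + 1) := Ideal.Quotient.eq_zero_iff_mem
  obtain ⟨s, hs⟩ := LinearMap.exists_rightInverse_of_surjective q.toLinearMap
    (LinearMap.range_eq_top.2 hq)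
  have hs' (a) : q (s a) = a := LinearMap.congr_fun hs a
  let J : Ideal (T ⧸ I ^ (k + 1)) := (I ^ k).map q
  have hJJ : ∀ a ∈ J, ∀ b ∈ J, a * b = 0 := by
    intro a ha b hb
    obtain ⟨a, ha', rfl⟩ := (Ideal.mem_map_iff_of_surjective q hq).1 ha
    obtain ⟨b, hb', rfl⟩ := (Ideal.mem_map_iff_of_surjective q hq).1 hb
    rw [← map_mul, hq0]
    refine Ideal.pow_le_pow_right (by omega : k + 1 ≤ k + k) ?_
    rw [pow_add]
    exact Ideal.mul_mem_mul ha' hb'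
  have hsJ : ∀ a ∈ J, s a ∈ I ^ k := by
    intro a ha
    obtain ⟨b, hb, rfl⟩ := (Ideal.mem_map_iff_of_surjective q hq).1 ha
    have : s (q b) - b ∈ I ^ k := Ideal.pow_le_pow_right (Nat.le_succ k) <| by
      rw [← hq0, map_sub, hs', sub_self]
    simpa using add_mem this hb
  have hJ : ∀ g i j, (π g).map q i j - (p g).map q i j ∈ J := fun g i j => by
    simpa using Ideal.mem_map_of_mem q (h g i j)
  have hπ' := hπ.map q
  have hp' := hp.map q
  have hder := isMatDer_sum_mul_sub_one hπ' hp' hJJ hJ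
  have hmem := sum_mul_sub_one_mem hp' hJ
  set E := ∑ g ∈ S, (π g).map q * (p g).map q - 1 with hE
  have hDk : ∀ i j, E.map s i j ∈ I ^ k := fun i j => hsJ _ (hmem i j)
  have hDI : ∀ i j, E.map s i j ∈ I := fun i j => Ideal.pow_le_self (by omega) (hDk i j)
  have hnil : IsNilpotent (E.map s) := ⟨N, by
    ext i j
    have := pow_apply_mem hDI N i j
    rwa [hN] at this⟩
  have hEE : E ^ 2 = 0 := by
    ext i j
    rw [pow_two, Matrix.mul_apply]
    exact Finset.sum_eq_zero fun l _ => hJJ _ (hmem i l) _ (hmem l j)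
  have hexp : (IsNilpotent.exp (E.map s)).map q = ∑ g ∈ S, (π g).map q * (p g).map q := by
    have h1 : q.mapMatrix (IsNilpotent.exp (E.map s)) = IsNilpotent.exp (q.mapMatrix (E.map s)) :=
      IsNilpotent.map_exp hnil _
    have h2 : q.mapMatrix (E.map s) = E := by ext i j; simp [hs']
    rw [h2, IsNilpotent.exp_eq_sum hEE] at h1
    rw [AlgHom.mapMatrix_apply] at h1
    rw [h1, Finset.sum_range_succ, Finset.sum_range_one, hE]
    simp
  refine ⟨IsNilpotent.exp (E.map s), IsNilpotent.exp (-E.map s),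
    IsNilpotent.exp_mul_exp_neg_self hnil, IsNilpotent.exp_neg_mul_exp_self hnil,
    (hder.map s).exp_map_mul hnil, fun g i j => ?_⟩
  have hinv : (IsNilpotent.exp (-E.map s)).map q * (IsNilpotent.exp (E.map s)).map q = 1 := by
    rw [← Matrix.map_mul, IsNilpotent.exp_neg_mul_exp_self hnil]; simp
  have hfin : (IsNilpotent.exp (-E.map s) * π g * IsNilpotent.exp (E.map s)).map q =
      (p g).map q := by
    have hcomm : (π g).map q * (∑ g ∈ S, (π g).map q * (p g).map q) =
        (∑ g ∈ S, (π g).map q * (p g).map q) * (p g).map q :=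
      (hπ'.proj_mul_sum (fun g => (p g).map q) g).trans
        (hp'.sum_mul_proj (fun g => (π g).map q) g).symm
    rw [Matrix.map_mul, Matrix.map_mul, mul_assoc, hexp, hcomm, ← mul_assoc, ← hexp, hinv, one_mul]
  rw [← hq0, map_sub, sub_eq_zero]
  exact congrFun (congrFun hfin i) j

/-- Rigidity: gradings which agree modulo a nilpotent ideal are isomorphic. -/
lemma exists_isMatIso_of_sub_mem [CommGroup G] [Algebra ℚ T] {S : Finset G} {I : Ideal T} {N : ℕ}
    (hN : I ^ N = ⊥) {π p : G → Matrix ι ι T} (hπ : IsMatGrading c S π)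
    (hp : IsMatGrading c S p) (h : ∀ g i j, π g i j - p g i j ∈ I) :
    ∃ φ ψ, IsMatIso c p π φ ψ := by
  suffices H : ∀ d k, 1 ≤ k → N ≤ k + d → ∀ π : G → Matrix ι ι T, IsMatGrading c S π →
      (∀ g i j, π g i j - p g i j ∈ I ^ k) → ∃ φ ψ, IsMatIso c p π φ ψ from
    H N 1 le_rfl (Nat.le_add_left N 1) π hπ (by simpa using h)
  intro d
  induction d with
  | zero =>
    intro k _ hNk π _ h
    have hbot : I ^ k = ⊥ := le_bot_iff.1 (hN ▸ Ideal.pow_le_pow_right hNk)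
    have : π = p := by
      ext g i j
      have := h g i j
      rwa [hbot, Ideal.mem_bot, sub_eq_zero] at this
    exact ⟨1, 1, this ▸ .refl _⟩
  | succ d ih =>
    intro k hk hNk π hπ h
    obtain ⟨φ, ψ, h1, h2, h3, h4⟩ := exists_aut_conj_sub_mem hN hk hπ hp h
    obtain ⟨φ', ψ', h'⟩ := ih (k + 1) (by omega) (by omega) _ (hπ.conj h1 h2 h3) h4
    have hiso : IsMatIso c (fun g => ψ * π g * φ) π φ ψ :=
      ⟨h1, h2, h3, fun g => by rw [mul_assoc, ← mul_assoc, h1, one_mul]⟩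
    exact ⟨_, _, h'.trans hiso⟩

lemma nonempty_algHom_of_finiteType (K B : Type*) [Field K] [IsAlgClosed K] [CommRing B]
    [Nontrivial B] [Algebra K B] [Algebra.FiniteType K B] : Nonempty (B →ₐ[K] K) := by
  obtain ⟨m, hm⟩ := Ideal.exists_maximal B
  let : Field (B ⧸ m) := Ideal.Quotient.field m
  have : Module.Finite K (B ⧸ m) := finite_of_finite_type_of_isJacobsonRing K (B ⧸ m)
  exact ⟨(IsAlgClosed.lift (R := K) (S := B ⧸ m) (M := K)).comp (Ideal.Quotient.mkₐ K m)⟩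

lemma nonempty_algHom_of_injective (R B K : Type*) [CommRing R] [IsDomain R] [CommRing B]
    [Algebra R B] [Algebra.FiniteType R B] [Field K] [IsAlgClosed K] [Algebra R K]
    (hB : Function.Injective (algebraMap R B)) (hK : Function.Injective (algebraMap R K)) :
    Nonempty (B →ₐ[R] K) := by
  have : FaithfulSMul R K := (faithfulSMul_iff_algebraMap_injective R K).2 hK
  let := FractionRing.liftAlgebra R K
  have : Module.Flat R K := Module.Flat.trans R (FractionRing R) K
  have : Nontrivial (K ⊗[R] B) := by
    have hinj := Module.Flat.lTensor_preserves_injective_linearMap (M := K) (Algebra.linearMap R B) hB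
    have : Nontrivial (K ⊗[R] R) := (TensorProduct.rid R K).toEquiv.nontrivial
    exact hinj.nontrivial
  obtain ⟨f⟩ := nonempty_algHom_of_finiteType K (K ⊗[R] B)
  exact ⟨(f.restrictScalars R).comp Algebra.TensorProduct.includeRight⟩

lemma IsMatIso.of_pi {N : Type*} {Q : N → Type*} [∀ n, CommRing (Q n)] [∀ n, Algebra F (Q n)]
    {p π : G → Matrix ι ι (∀ n, Q n)} {φ ψ : Matrix ι ι (∀ n, Q n)}
    (h : ∀ n, IsMatIso c (fun g => (p g).map (Pi.evalAlgHom F Q n))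
      (fun g => (π g).map (Pi.evalAlgHom F Q n)) (φ.map (Pi.evalAlgHom F Q n))
      (ψ.map (Pi.evalAlgHom F Q n))) : IsMatIso c p π φ ψ := by
  have hext {M M' : Matrix ι ι (∀ n, Q n)}
      (hM : ∀ n, M.map (Pi.evalAlgHom F Q n) = M'.map (Pi.evalAlgHom F Q n)) : M = M' := by
    ext i j n
    exact congrFun (congrFun (hM n) i) j
  refine ⟨hext fun n => ?_, hext fun n => ?_, fun x y => ?_, fun g => hext fun n => ?_⟩
  · simpa [Matrix.map_mul] using (h n).mul_inv
  · simpa [Matrix.map_mul] using (h n).inv_mul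
  · ext i n
    have := (h n).map_mul (Pi.evalAlgHom F Q n ∘ x) (Pi.evalAlgHom F Q n ∘ y)
    simp only [← comp_mulVec, ← comp_structMul] at this
    exact congrFun this i
  · simpa only [Matrix.map_mul] using (h n).comm g

lemma exists_isMatIso_of_pi_quotient [CommGroup G] [CharZero F] {R : Type*} [CommRing R]
    [Algebra F R] {S : Finset G} {π : G → Matrix ι ι R} (hπ : IsMatGrading c S π) (ev : R →ₐ[F] F) :
    ∃ φ ψ : Matrix ι ι (∀ n : ℕ, R ⧸ (RingHom.ker ev) ^ n),
      IsMatIso c (fun g => ((π g).map ev).map (Algebra.ofId F _))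
        (fun g => (π g).map (Algebra.ofId R _)) φ ψ := by
  have key (n : ℕ) : ∃ φ ψ : Matrix ι ι (R ⧸ (RingHom.ker ev) ^ n),
      IsMatIso c (fun g => ((π g).map ev).map (Algebra.ofId F _))
        (fun g => (π g).map (Ideal.Quotient.mkₐ F ((RingHom.ker ev) ^ n))) φ ψ := by
    let : Algebra ℚ (R ⧸ (RingHom.ker ev) ^ n) :=
      ((algebraMap F _).comp (algebraMap ℚ F)).toAlgebra
    refine exists_isMatIso_of_sub_mem (S := S)
      (I := (RingHom.ker ev).map (Ideal.Quotient.mk ((RingHom.ker ev) ^ n))) (N := n)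
      (by rw [← Ideal.map_pow, Ideal.map_quotient_self]) (hπ.map _) ((hπ.map ev).map _)
      fun g i j => ?_
    have : π g i j - algebraMap F R (ev (π g i j)) ∈ RingHom.ker ev := by
      simp [RingHom.mem_ker]
    simpa using Ideal.mem_map_of_mem (Ideal.Quotient.mk ((RingHom.ker ev) ^ n)) this
  choose φ ψ h using key
  exact ⟨.of fun i j n => φ n i j, .of fun i j n => ψ n i j, .of_pi h⟩

/-- A grading over a finitely generated domain `R` becomes isomorphic over any algebraically closed
field containing `R` to its specialization at any `F`-point. -/
lemma exists_isMatIso_specialization [CommGroup G] [CharZero F] {R K : Type*} [CommRing R]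
    [IsDomain R] [Algebra F R] [Algebra.FiniteType F R] [Field K] [IsAlgClosed K] [Algebra F K]
    [Algebra R K] [IsScalarTower F R K] (hK : Function.Injective (algebraMap R K)) {S : Finset G}
    {π : G → Matrix ι ι R} (hπ : IsMatGrading c S π) (ev : R →ₐ[F] F) :
    ∃ φ ψ : Matrix ι ι K, IsMatIso c (fun g => ((π g).map ev).map (algebraMap F K))
      (fun g => (π g).map (algebraMap R K)) φ ψ := by
  have : IsNoetherianRing R := Algebra.FiniteType.isNoetherianRing F R
  obtain ⟨φ, ψ, h⟩ := exists_isMatIso_of_pi_quotient hπ ev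
  let P := ∀ n : ℕ, R ⧸ (RingHom.ker ev) ^ n
  have hRP : Function.Injective (algebraMap R P) := by
    rw [injective_iff_map_eq_zero]
    intro a ha
    have hmem : a ∈ ⨅ n : ℕ, (RingHom.ker ev) ^ n :=
      Ideal.mem_iInf.2 fun n => Ideal.Quotient.eq_zero_iff_mem.1 (congrFun ha n)
    rwa [Ideal.iInf_pow_eq_bot_of_isDomain _ (RingHom.ker_ne_top ev)] at hmem
  let E : Set P := Set.range (fun x : ι × ι => φ x.1 x.2) ∪ Set.range (fun x : ι × ι => ψ x.1 x.2)
  let B : Subalgebra R P := Algebra.adjoin R E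
  have hBfg : Algebra.FiniteType R B :=
    B.fg_iff_finiteType.1 (Subalgebra.fg_def.2
      ⟨E, (Set.finite_range _).union (Set.finite_range _), rfl⟩)
  let φB : Matrix ι ι B :=
    .of fun i j => ⟨φ i j, Algebra.subset_adjoin (Or.inl ⟨(i, j), rfl⟩)⟩
  let ψB : Matrix ι ι B :=
    .of fun i j => ⟨ψ i j, Algebra.subset_adjoin (Or.inr ⟨(i, j), rfl⟩)⟩
  have hB : IsMatIso c (fun g => ((π g).map ev).map (algebraMap F B))
      (fun g => (π g).map (algebraMap R B)) φB ψB :=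
    .of_map (B.val.restrictScalars F) Subtype.val_injective h
  obtain ⟨f⟩ := nonempty_algHom_of_injective R B K
    (fun a b hab => hRP (congrArg Subtype.val hab)) hK
  have hfin := hB.map (f.restrictScalars F)
  refine ⟨φB.map (f.restrictScalars F), ψB.map (f.restrictScalars F), ?_⟩
  convert hfin using 2 with g g
  · ext i j
    exact ((f.restrictScalars F).commutes _).symm
  · ext i j
    exact (f.commutes _).symm

/-- Gradings in coordinates descend, up to isomorphism, along extensions of algebraically closed
fields of characteristic zero. -/
theorem IsMatGrading.descends [CommGroup G] [CharZero F] [IsAlgClosed F] {K : Type*} [Field K]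
    [IsAlgClosed K] [Algebra F K] {S : Finset G} {π : G → Matrix ι ι K}
    (hπ : IsMatGrading c S π) :
    ∃ p : G → Matrix ι ι F, IsMatGrading c S p ∧
      ∃ φ ψ : Matrix ι ι K, IsMatIso c (fun g => (p g).map (algebraMap F K)) π φ ψ := by
  let E : Set K := Set.range fun x : S × ι × ι => π x.1 x.2.1 x.2.2
  let R : Subalgebra F K := Algebra.adjoin F E
  have hmem (g : G) (i j : ι) : π g i j ∈ R := by
    by_cases hg : g ∈ S
    · exact Algebra.subset_adjoin ⟨(⟨g, hg⟩, i, j), rfl⟩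
    · rw [hπ.eq_zero g hg]
      exact R.zero_mem
  have hRfg : Algebra.FiniteType F R :=
    R.fg_iff_finiteType.1 (Subalgebra.fg_def.2 ⟨E, Set.finite_range _, rfl⟩)
  let πR (g : G) : Matrix ι ι R := .of fun i j => ⟨π g i j, hmem g i j⟩
  have hπR : IsMatGrading c S πR := .of_map R.val Subtype.val_injective hπ
  obtain ⟨ev⟩ := nonempty_algHom_of_finiteType F R
  exact ⟨_, hπR.map ev, exists_isMatIso_specialization Subtype.val_injective hπR ev⟩

end StructureConstants

section Coordinates

open Module

variable {F ι G : Type*} [Field F] [Fintype ι] [DecidableEq ι] [CommGroup G]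
  {c : ι → ι → ι → F} {K M : Type*} [Field K] [Algebra F K] [NonUnitalNonAssocRing M] [Module K M]
  [SMulCommClass K M M] [IsScalarTower K M M] {B : Basis ι K M}

omit [DecidableEq ι] in
lemma equivFun_mul (hB : ∀ i j k, B.repr (B i * B j) k = algebraMap F K (c i j k)) (x y : M) :
    B.equivFun (x * y) = structMul c K (B.equivFun x) (B.equivFun y) := by
  classical
  have : (LinearMap.mul K M).compr₂ B.equivFun.toLinearMap =
      (structMul c K).compl₁₂ B.equivFun.toLinearMap B.equivFun.toLinearMap := by
    refine LinearMap.ext_basis B B fun i j => ?_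
    ext k
    simp [structMul_apply, hB, Finsupp.single_apply]
  exact LinearMap.congr_fun (LinearMap.congr_fun this x) y

omit [SMulCommClass K M M] [IsScalarTower K M M] in
lemma equivFun_toLin (A : Matrix ι ι K) (x : M) :
    B.equivFun (Matrix.toLin B B A x) = A.mulVec (B.equivFun x) := by
  have := LinearMap.toMatrix_mulVec_repr B B (Matrix.toLin B B A) x
  rw [LinearMap.toMatrix_toLin] at this
  exact this.symm

omit [SMulCommClass K M M] [IsScalarTower K M M] in
lemma mulVec_equivFun (f : M →ₗ[K] M) (x : M) :
    (LinearMap.toMatrix B B f).mulVec (B.equivFun x) = B.equivFun (f x) :=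
  LinearMap.toMatrix_mulVec_repr B B f x

lemma toLin_map_mul (hB : ∀ i j k, B.repr (B i * B j) k = algebraMap F K (c i j k))
    {φ : Matrix ι ι K}
    (hφ : ∀ x y, φ.mulVec (structMul c K x y) = structMul c K (φ.mulVec x) (φ.mulVec y)) (x y : M) :
    Matrix.toLin B B φ (x * y) = Matrix.toLin B B φ x * Matrix.toLin B B φ y := by
  apply B.equivFun.injective
  simp only [equivFun_toLin, equivFun_mul hB, hφ]

lemma IsMatGrading.isGrading (hB : ∀ i j k, B.repr (B i * B j) k = algebraMap F K (c i j k))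
    {S : Finset G} {π : G → Matrix ι ι K} (h : IsMatGrading c S π) :
    IsGrading fun g => LinearMap.range (Matrix.toLin B B (π g)) := by
  have hself (g : G) (x : M) :
      Matrix.toLin B B (π g) (Matrix.toLin B B (π g) x) = Matrix.toLin B B (π g) x := by
    rw [← Matrix.toLin_mul_apply, h.mul_self]
  refine ⟨fun g => ?_, ?_, ?_⟩
  · rw [Submodule.disjoint_def]
    rintro _ ⟨x, rfl⟩ hx
    have hle : ⨆ g', ⨆ (_ : g' ≠ g), LinearMap.range (Matrix.toLin B B (π g')) ≤
        LinearMap.ker (Matrix.toLin B B (π g)) := by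
      refine iSup₂_le fun g' hg => ?_
      rintro _ ⟨y, rfl⟩
      rw [LinearMap.mem_ker, ← Matrix.toLin_mul_apply, h.mul_of_ne _ _ hg.symm]
      simp
    rw [← hself]
    exact hle hx
  · rw [eq_top_iff]
    intro x _
    have : x = ∑ g ∈ S, Matrix.toLin B B (π g) x := by
      rw [← LinearMap.sum_apply, ← map_sum, h.sum_eq]
      simp
    rw [this]
    exact Submodule.sum_mem _ fun g _ => Submodule.mem_iSup_of_mem g ⟨x, rfl⟩
  · rintro g g' _ _ ⟨x, rfl⟩ ⟨y, rfl⟩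
    refine ⟨Matrix.toLin B B (π g) x * Matrix.toLin B B (π g') y, ?_⟩
    apply B.equivFun.injective
    simp only [equivFun_toLin, equivFun_mul hB, h.mul_mem]

lemma IsGrading.exists_isMatGrading
    (hB : ∀ i j k, B.repr (B i * B j) k = algebraMap F K (c i j k))
    {Δ : G → Submodule K M} (hΔ : IsGrading Δ) :
    ∃ (S : Finset G) (π : G → Matrix ι ι K), IsMatGrading c S π ∧
      ∀ g, LinearMap.range (Matrix.toLin B B (π g)) = Δ g := by
  classical
  obtain ⟨hind, htop, hmul⟩ := hΔ
  have : FiniteDimensional K M := B.finiteDimensional_of_finite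
  let _ : DirectSum.Decomposition Δ :=
    (DirectSum.isInternal_submodule_of_iSupIndep_of_iSup_eq_top hind htop).chooseDecomposition
  let P (g : G) : M →ₗ[K] M :=
    (Δ g).subtype ∘ₗ DirectSum.component K G (fun g => Δ g) g ∘ₗ
      (DirectSum.decomposeLinearEquiv Δ).toLinearMap
  have hPmem (g x) : P g x ∈ Δ g := Submodule.coe_mem _
  have hPsame {g x} (hx : x ∈ Δ g) : P g x = x := DirectSum.decompose_of_mem_same Δ hx
  have hPne {g g' x} (hx : x ∈ Δ g) (hg : g ≠ g') : P g' x = 0 :=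
    DirectSum.decompose_of_mem_ne Δ hx hg
  have hfin : {g | Δ g ≠ ⊥}.Finite := WellFoundedGT.finite_ne_bot_of_iSupIndep hind
  have hP0 : ∀ g ∉ hfin.toFinset, P g = 0 := by
    intro g hg
    ext x
    have hbot : Δ g = ⊥ := by simpa using hg
    simpa [hbot] using hPmem g x
  have hmat (A : M →ₗ[K] M) (x : ι → K) : (LinearMap.toMatrix B B A).mulVec x =
      B.equivFun (A (B.equivFun.symm x)) := by
    rw [← mulVec_equivFun, LinearEquiv.apply_symm_apply]
  refine ⟨hfin.toFinset, fun g => LinearMap.toMatrix B B (P g), ⟨?_, ?_, ?_, ?_, ?_⟩, fun g => ?_⟩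
  · intro g hg
    rw [hP0 g hg, map_zero]
  · intro g g' hg
    rw [← LinearMap.toMatrix_comp]
    have : P g ∘ₗ P g' = 0 := LinearMap.ext fun x => hPne (hPmem g' x) hg.symm
    rw [this, map_zero]
  · intro g
    rw [← LinearMap.toMatrix_comp]
    congr 1
    exact LinearMap.ext fun x => hPsame (hPmem g x)
  · rw [← map_sum, ← LinearMap.toMatrix_id B]
    congr 1
    ext x
    have hx : x ∈ ⨆ g, Δ g := htop ▸ Submodule.mem_top
    induction hx using Submodule.iSup_induction' with
    | mem g x hx =>
      rw [LinearMap.sum_apply, Finset.sum_eq_single g (fun g' _ hg => hPne hx hg.symm)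
        (fun hg => by rw [hP0 g hg, LinearMap.zero_apply])]
      exact hPsame hx
    | zero => simp
    | add x y _ _ hx hy => rw [map_add, map_add, hx, hy]
  · intro g g' x y
    simp only [hmat, ← equivFun_mul hB, LinearEquiv.symm_apply_apply]
    rw [hPsame (hmul g g' _ _ (hPmem g _) (hPmem g' _))]
  · rw [Matrix.toLin_toMatrix]
    ext x
    exact ⟨by rintro ⟨y, rfl⟩; exact hPmem g y, fun hx => ⟨x, hPsame hx⟩⟩

end Coordinates

lemma baseChange_range {R M N : Type*} (S : Type*) [CommSemiring R] [Semiring S] [Algebra R S]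
    [AddCommMonoid M] [Module R M] [AddCommMonoid N] [Module R N] (f : M →ₗ[R] N) :
    (LinearMap.range f).baseChange S = LinearMap.range (f.baseChange S) := by
  refine le_antisymm ?_ ?_
  · rw [Submodule.baseChange_eq_span, Submodule.span_le]
    rintro _ ⟨_, ⟨x, rfl⟩, rfl⟩
    exact ⟨1 ⊗ₜ x, by simp⟩
  · rintro _ ⟨x, rfl⟩
    induction x using TensorProduct.induction_on with
    | zero => simp
    | tmul a x => exact Submodule.tmul_mem_baseChange_of_mem a ⟨x, rfl⟩
    | add x y hx hy => rw [map_add]; exact add_mem hx hy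

/-- over algebraically closed fields `F ⊆ K` of characteristic zero, every
`G`-grading on `A_K` is isomorphic to the scalar extension of a `G`-grading on `A`. -/
theorem grading_descends_up_to_iso
    {F : Type*} [Field F] [IsAlgClosed F] [CharZero F]
    {K : Type*} [Field K] [Algebra F K] [IsAlgClosed K]
    {A : Type*} [NonUnitalNonAssocRing A] [Module F A]
    [SMulCommClass F A A] [IsScalarTower F A A] [FiniteDimensional F A]
    {G : Type*} [CommGroup G] [Group.FG G]
    (Δ : G → Submodule K (K ⊗[F] A)) (hΔ : IsGrading Δ) :
    ∃ comp : G → Submodule F A, IsGrading comp ∧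
      GradingIso (fun g : G => (comp g).baseChange K) Δ := by
  let b := Module.finBasis F A
  let B := Algebra.TensorProduct.basis K b
  let c := fun i j k => b.repr (b i * b j) k
  have hB : ∀ i j k, B.repr (B i * B j) k = algebraMap F K (c i j k) := fun i j k => by
    simp [B, c, Algebra.TensorProduct.tmul_mul_tmul, Algebra.algebraMap_eq_smul_one]
  obtain ⟨S, π, hπ, hrange⟩ := hΔ.exists_isMatGrading hB
  obtain ⟨p, hp, φ, ψ, h⟩ := hπ.descends
  refine ⟨_, hp.isGrading (B := b) fun i j k => rfl, Matrix.toLinOfInv B B h.mul_inv h.inv_mul,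
    fun x y => toLin_map_mul hB h.map_mul x y, fun g => ?_⟩
  have hpK : (Matrix.toLin b b (p g)).baseChange K =
      Matrix.toLin B B ((p g).map (algebraMap F K)) := by
    apply (LinearMap.toMatrix B B).injective
    rw [LinearMap.toMatrix_toLin, LinearMap.toMatrix_baseChange, LinearMap.toMatrix_toLin]
  have hbase : (LinearMap.range (Matrix.toLin b b (p g))).baseChange K =
      LinearMap.range (Matrix.toLin B B ((p g).map (algebraMap F K))) := by
    rw [← hpK, baseChange_range]
  have hcomm : Matrix.toLin B B φ ∘ₗ Matrix.toLin B B ((p g).map (algebraMap F K)) =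
      Matrix.toLin B B (π g) ∘ₗ Matrix.toLin B B φ := by
    rw [← Matrix.toLin_mul, ← Matrix.toLin_mul, h.comm g]
  have hsurj : LinearMap.range (Matrix.toLin B B φ) = ⊤ :=
    LinearMap.range_eq_top.2 (Matrix.toLinOfInv B B h.mul_inv h.inv_mul).surjective
  change ((LinearMap.range (Matrix.toLin b b (p g))).baseChange K).map (Matrix.toLin B B φ) = Δ g
  rw [hbase, ← LinearMap.range_comp, hcomm, LinearMap.range_comp, hsurj, Submodule.map_top, hrange]
end

section
/- Let F be an algebraically closed field of characteristic 0, K/F a field extension with K algebraically closed, and A a finite-dimensional nonassociative F-algebra. Let G and H be abelian groups, Γ : A = ⊕_{g∈G} A_g a G-grading and Γ' : A = ⊕_{h∈H} A'_h an H-grading on A. Then Γ is equivalent to Γ' if and only if the extended gradings Γ_K and Γ'_K on A_K = A ⊗_F K are equivalent. -/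
open scoped TensorProduct

universe u

/-- A nontrivial finitely generated commutative algebra over an algebraically closed field
has a rational point. -/
theorem nonempty_algHom_of_finiteType_of_isAlgClosed (F R : Type*) [Field F] [IsAlgClosed F]
    [CommRing R] [Nontrivial R] [Algebra F R] [Algebra.FiniteType F R] :
    Nonempty (R →ₐ[F] F) := by
  obtain ⟨m, hm⟩ := Ideal.exists_maximal R
  let : Field (R ⧸ m) := Ideal.Quotient.field m
  have : Module.Finite F (R ⧸ m) := finite_of_finite_type_of_isJacobsonRing F (R ⧸ m)
  have : Algebra.IsAlgebraic F (R ⧸ m) := Algebra.IsAlgebraic.of_finite F (R ⧸ m)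
  exact ⟨(IsAlgClosed.lift : (R ⧸ m) →ₐ[F] F).comp (Ideal.Quotient.mkₐ F m)⟩

/-- A finite subset of an extension `K` of an algebraically closed field `F` lies in a subalgebra
on which some `F`-linear functional of `K` is a homomorphism of `F`-algebras. -/
theorem exists_linearMap_mul_on_subalgebra {F K : Type*} [Field F] [IsAlgClosed F] [Field K]
    [Algebra F K] (S : Set K) (hS : S.Finite) :
    ∃ (R : Subalgebra F K) (ρ : K →ₗ[F] F), S ⊆ R ∧ ρ 1 = 1 ∧
      ∀ x ∈ R, ∀ y ∈ R, ρ (x * y) = ρ x * ρ y := by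
  have : Algebra.FiniteType F (Algebra.adjoin F S) := Algebra.FiniteType.adjoin_of_finite hS
  obtain ⟨f⟩ := nonempty_algHom_of_finiteType_of_isAlgClosed F (Algebra.adjoin F S)
  obtain ⟨ρ, hρ⟩ := LinearMap.exists_extend
    (p := Subalgebra.toSubmodule (Algebra.adjoin F S)) f.toLinearMap
  have hρ' (x : Algebra.adjoin F S) : ρ x = f x := LinearMap.congr_fun hρ x
  refine ⟨Algebra.adjoin F S, ρ, Algebra.subset_adjoin, ?_, fun x hx y hy => ?_⟩
  · simpa using hρ' 1
  · simpa using (hρ' (⟨x, hx⟩ * ⟨y, hy⟩)).trans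
      (by rw [map_mul, ← hρ' ⟨x, hx⟩, ← hρ' ⟨y, hy⟩])

section Specialization

variable {F : Type*} [Field F] {K : Type*} [Field K] [Algebra F K]

section Linear

variable {A : Type*} [AddCommGroup A] [Module F A]

/-- The `F`-subspace of `K ⊗ A` of elements with coefficients in the subalgebra `R` of `K`. -/
def coeffSpan (R : Subalgebra F K) (A : Type*) [AddCommGroup A] [Module F A] :
    Submodule F (K ⊗[F] A) :=
  Submodule.span F {u | ∃ r ∈ R, ∃ a : A, r ⊗ₜ[F] a = u}

/-- The linear map `K ⊗ A → A` applying a functional of `K` to the coefficients. -/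
def evalCoeff (ρ : K →ₗ[F] F) (A : Type*) [AddCommGroup A] [Module F A] : K ⊗[F] A →ₗ[F] A :=
  TensorProduct.lift (LinearMap.lsmul F A ∘ₗ ρ)

@[simp]
theorem evalCoeff_tmul (ρ : K →ₗ[F] F) (k : K) (a : A) :
    evalCoeff ρ A (k ⊗ₜ[F] a) = ρ k • a := rfl

theorem evalCoeff_smul {R : Subalgebra F K} {ρ : K →ₗ[F] F}
    (hmul : ∀ x ∈ R, ∀ y ∈ R, ρ (x * y) = ρ x * ρ y) {r : K} (hr : r ∈ R)
    {u : K ⊗[F] A} (hu : u ∈ coeffSpan R A) :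
    evalCoeff ρ A (r • u) = ρ r • evalCoeff ρ A u := by
  induction hu using Submodule.span_induction with
  | mem u hu =>
    obtain ⟨s, hs, a, rfl⟩ := hu
    simp [TensorProduct.smul_tmul', hmul r hr s hs, mul_smul]
  | zero => simp
  | add u v _ _ hu hv => rw [smul_add, map_add, hu, hv, map_add, smul_add]
  | smul c u _ hu => rw [smul_comm, map_smul, hu, map_smul, smul_comm]

theorem evalCoeff_mem (ρ : K →ₗ[F] F) {p : Submodule F A} {u : K ⊗[F] A}
    (hu : u ∈ p.baseChange K) : evalCoeff ρ A u ∈ p := by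
  have h : u ∈ LinearMap.range (p.subtype.baseChange K) := hu
  obtain ⟨v, rfl⟩ := h
  clear hu
  induction v using TensorProduct.induction_on with
  | zero => simp
  | tmul k a => simpa using p.smul_mem _ a.2
  | add v w hv hw =>
    rw [map_add, map_add]
    exact p.add_mem hv hw

theorem apply_one_tmul_mem_coeffSpan {ι : Type*} (b : Module.Basis ι F A) {R : Subalgebra F K}
    (φ : K ⊗[F] A →ₗ[K] K ⊗[F] A)
    (h : ∀ i j, (b.baseChange K).repr (φ (1 ⊗ₜ[F] b j)) i ∈ R) (a : A) :
    φ (1 ⊗ₜ[F] a) ∈ coeffSpan R A := by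
  let f : A →ₗ[F] K ⊗[F] A := φ.restrictScalars F ∘ₗ TensorProduct.mk F K A 1
  have : (⊤ : Submodule F A) ≤ (coeffSpan R A).comap f := by
    rw [← b.span_eq, Submodule.span_le]
    rintro _ ⟨j, rfl⟩
    change φ (1 ⊗ₜ[F] b j) ∈ coeffSpan R A
    rw [← (b.baseChange K).linearCombination_repr (φ (1 ⊗ₜ[F] b j)),
      Finsupp.linearCombination_apply]
    refine Submodule.sum_mem _ fun i _ => Submodule.subset_span ⟨_, h i j, b i, ?_⟩
    simp [TensorProduct.smul_tmul']
  exact this (Submodule.mem_top : a ∈ ⊤)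

theorem evalCoeff_comp {R : Subalgebra F K} {ρ : K →ₗ[F] F}
    (hmul : ∀ x ∈ R, ∀ y ∈ R, ρ (x * y) = ρ x * ρ y) {φ : K ⊗[F] A →ₗ[K] K ⊗[F] A}
    (hφ : ∀ a : A, φ (1 ⊗ₜ[F] a) ∈ coeffSpan R A) {u : K ⊗[F] A} (hu : u ∈ coeffSpan R A) :
    evalCoeff ρ A (φ (1 ⊗ₜ[F] evalCoeff ρ A u)) = evalCoeff ρ A (φ u) := by
  induction hu using Submodule.span_induction with
  | mem u hu =>
    obtain ⟨r, hr, a, rfl⟩ := hu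
    have : r ⊗ₜ[F] a = r • ((1 : K) ⊗ₜ[F] a) := by simp [TensorProduct.smul_tmul']
    rw [evalCoeff_tmul, TensorProduct.tmul_smul, LinearMap.map_smul_of_tower, map_smul, this,
      LinearMap.map_smul φ, evalCoeff_smul hmul hr (hφ a)]
  | zero => simp
  | add u v _ _ hu hv => simp only [map_add, TensorProduct.tmul_add, hu, hv]
  | smul c u _ hu =>
    rw [map_smul, TensorProduct.tmul_smul, LinearMap.map_smul_of_tower, map_smul, hu,
      LinearMap.map_smul_of_tower, map_smul]

theorem baseChange_eq_bot_iff_of_field (p : Submodule F A) : p.baseChange K = ⊥ ↔ p = ⊥ := by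
  refine ⟨fun h => ?_, fun h => by rw [h, Submodule.baseChange_bot]⟩
  rw [Submodule.eq_bot_iff] at h ⊢
  intro a ha
  have h1 := h _ (Submodule.tmul_mem_baseChange_of_mem (1 : K) ha)
  exact Module.FaithfullyFlat.tensorProduct_mk_injective (A := F) (B := K) A
    (h1.trans (TensorProduct.tmul_zero A (1 : K)).symm)

theorem map_baseChange_linearEquiv (φ : A ≃ₗ[F] A) (p : Submodule F A) :
    (p.baseChange K).map (φ.baseChange F K A A : K ⊗[F] A →ₗ[K] K ⊗[F] A) =
      (p.map (φ : A →ₗ[F] A)).baseChange K := by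
  rw [← p.span_eq, Submodule.baseChange_span, Submodule.map_span, Submodule.map_span,
    Submodule.baseChange_span, ← Set.image_comp, ← Set.image_comp]
  rfl

end Linear

section Algebra

variable {A : Type*} [NonUnitalNonAssocRing A] [Module F A]
  [SMulCommClass F A A] [IsScalarTower F A A]

/-- Extending scalars does not change the support of a family of subspaces. -/
theorem gradingSupp_baseChange {G : Type*} [CommGroup G] (p : G → Submodule F A) :
    gradingSupp (fun g => (p g).baseChange K) = gradingSupp p :=
  Set.ext fun g => (baseChange_eq_bot_iff_of_field (p g)).not

theorem evalCoeff_mul {R : Subalgebra F K} {ρ : K →ₗ[F] F}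
    (hmul : ∀ x ∈ R, ∀ y ∈ R, ρ (x * y) = ρ x * ρ y) {u v : K ⊗[F] A}
    (hu : u ∈ coeffSpan R A) (hv : v ∈ coeffSpan R A) :
    evalCoeff ρ A (u * v) = evalCoeff ρ A u * evalCoeff ρ A v := by
  induction hu using Submodule.span_induction with
  | mem u hu =>
    obtain ⟨r, hr, a, rfl⟩ := hu
    induction hv using Submodule.span_induction with
    | mem v hv =>
      obtain ⟨s, hs, b, rfl⟩ := hv
      simp [hmul r hr s hs, smul_mul_smul_comm]
    | zero => simp
    | add v w _ _ hv hw => rw [mul_add, map_add, hv, hw, map_add, mul_add]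
    | smul c v _ hv => rw [mul_smul_comm, map_smul, hv, map_smul, mul_smul_comm]
  | zero => simp
  | add u w _ _ hu hw => rw [add_mul, map_add, hu, hw, map_add, add_mul]
  | smul c u _ hu => rw [smul_mul_assoc, map_smul, hu, map_smul, smul_mul_assoc]

theorem IsAlgAut.baseChange {φ : A ≃ₗ[F] A} (hφ : IsAlgAut φ) :
    IsAlgAut (φ.baseChange F K A A) := by
  intro u v
  induction u using TensorProduct.induction_on with
  | zero => simp
  | tmul r a =>
    induction v using TensorProduct.induction_on with
    | zero => simp
    | tmul s b => simp [hφ a b]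
    | add v w hv hw => simp only [mul_add, map_add, hv, hw]
  | add u w hu hw => simp only [add_mul, map_add, hu, hw]

/-- An algebra automorphism of `K ⊗ A` can be specialized to an algebra automorphism of `A`
respecting every pair of subspaces defined over `F` that it respects. -/
theorem IsAlgAut.exists_specialization [IsAlgClosed F] [FiniteDimensional F A]
    {φ : K ⊗[F] A ≃ₗ[K] K ⊗[F] A} (hφ : IsAlgAut φ) :
    ∃ ψ : A ≃ₗ[F] A, IsAlgAut ψ ∧ ∀ p q : Submodule F A,
      (p.baseChange K).map (φ : K ⊗[F] A →ₗ[K] K ⊗[F] A) = q.baseChange K →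
        p.map (ψ : A →ₗ[F] A) = q := by
  let b := Module.finBasis F A
  let c (χ : K ⊗[F] A →ₗ[K] K ⊗[F] A) (x : Fin (Module.finrank F A) × Fin (Module.finrank F A)) :=
    (b.baseChange K).repr (χ (1 ⊗ₜ[F] b x.2)) x.1
  obtain ⟨R, ρ, hS, h1, hmul⟩ := exists_linearMap_mul_on_subalgebra (F := F)
    (Set.range (c φ) ∪ Set.range (c φ.symm)) ((Set.finite_range _).union (Set.finite_range _))
  have hR := apply_one_tmul_mem_coeffSpan b (R := R) (φ : K ⊗[F] A →ₗ[K] K ⊗[F] A)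
    fun i j => hS (Or.inl ⟨(i, j), rfl⟩)
  have hR' := apply_one_tmul_mem_coeffSpan b (R := R) (φ.symm : K ⊗[F] A →ₗ[K] K ⊗[F] A)
    fun i j => hS (Or.inr ⟨(i, j), rfl⟩)
  let s (χ : K ⊗[F] A →ₗ[K] K ⊗[F] A) : A →ₗ[F] A :=
    evalCoeff ρ A ∘ₗ χ.restrictScalars F ∘ₗ TensorProduct.mk F K A 1
  have hleft (a : A) : s φ.symm (s φ a) = a :=
    (evalCoeff_comp hmul hR' (hR a)).trans (by simp [h1])
  have hright (a : A) : s φ (s φ.symm a) = a :=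
    (evalCoeff_comp hmul hR (hR' a)).trans (by simp [h1])
  refine ⟨LinearEquiv.ofLinearMap (s φ) (s φ.symm) (LinearMap.ext hright) (LinearMap.ext hleft),
    fun x y => ?_, fun p q hpq => le_antisymm ?_ fun y hy => ⟨s φ.symm y, ?_, hright y⟩⟩
  · change evalCoeff ρ A (φ (1 ⊗ₜ[F] (x * y))) = _
    have : (1 : K) ⊗ₜ[F] (x * y) = (1 ⊗ₜ[F] x) * (1 ⊗ₜ[F] y) := by simp
    rw [this, hφ]
    exact evalCoeff_mul hmul (hR x) (hR y)
  · rintro _ ⟨x, hx, rfl⟩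
    refine evalCoeff_mem (K := K) ρ ?_
    rw [← hpq]
    exact Submodule.mem_map_of_mem (Submodule.tmul_mem_baseChange_of_mem (1 : K) hx)
  · refine evalCoeff_mem (K := K) ρ ?_
    have h := Submodule.tmul_mem_baseChange_of_mem (1 : K) hy
    rw [← hpq] at h
    obtain ⟨u, hu, hu'⟩ := h
    change φ.symm (1 ⊗ₜ[F] y) ∈ _
    rwa [← hu', LinearEquiv.coe_coe, LinearEquiv.symm_apply_apply]

end Algebra

end Specialization

/-- two gradings on `A` are equivalent iff their scalar extensions are. -/
theorem gradingEquiv_iff_baseChange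
    {F : Type*} [Field F] [IsAlgClosed F] [CharZero F]
    {K : Type*} [Field K] [Algebra F K] [IsAlgClosed K]
    {A : Type*} [NonUnitalNonAssocRing A] [Module F A]
    [SMulCommClass F A A] [IsScalarTower F A A] [FiniteDimensional F A]
    {G : Type*} [CommGroup G] {H : Type*} [CommGroup H]
    (comp : G → Submodule F A) (comp' : H → Submodule F A)
    (hcomp : IsGrading comp) (hcomp' : IsGrading comp') :
    GradingEquiv comp comp' ↔
      GradingEquiv (fun g : G => (comp g).baseChange K)
        (fun h : H => (comp' h).baseChange K) := by
  constructor
  · rintro ⟨α, φ, hφ, hα, h⟩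
    refine ⟨α, φ.baseChange F K A A, hφ.baseChange, ?_, fun g hg => ?_⟩
    · rwa [gradingSupp_baseChange, gradingSupp_baseChange]
    · rw [map_baseChange_linearEquiv, h g (gradingSupp_baseChange (K := K) comp ▸ hg)]
  · rintro ⟨α, φ, hφ, hα, h⟩
    obtain ⟨ψ, hψ, hψ'⟩ := hφ.exists_specialization
    rw [gradingSupp_baseChange, gradingSupp_baseChange] at hα
    exact ⟨α, ψ, hψ, hα, fun g hg =>
      hψ' _ _ (h g ((gradingSupp_baseChange (K := K) comp).symm ▸ hg))⟩
end

section
/- Let F be an algebraically closed field of characteristic 0, K/F a field extension with K algebraically closed, and A a finite-dimensional nonassociative F-algebra. Then every grading on A_K = A ⊗_F K by any abelian group is equivalent to an extended grading: for every abelian group H and every H-grading Δ on A_K, there exist an abelian group G and a G-grading Γ on A such that Γ_K is equivalent to Δ. -/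
open scoped TensorProduct

universe u

/-- Weak Nullstellensatz: maximal ideals are kernels of points. -/
lemma exists_algHom_ker_eq {F R : Type*} [Field F] [IsAlgClosed F] [CommRing R] [Algebra F R]
    [Algebra.FiniteType F R] (M : Ideal R) [M.IsMaximal] :
    ∃ χ : R →ₐ[F] F, ∀ r, χ r = 0 ↔ r ∈ M := by
  let := Ideal.Quotient.field M
  have : Module.Finite F (R ⧸ M) := finite_of_finite_type_of_isJacobsonRing F (R ⧸ M)
  let e : F ≃ₐ[F] (R ⧸ M) := AlgEquiv.ofBijective (Algebra.ofId F _)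
    (IsAlgClosed.algebraMap_bijective_of_isIntegral (k := F) (K := R ⧸ M))
  refine ⟨e.symm.toAlgHom.comp (Ideal.Quotient.mkₐ F M), fun r => ?_⟩
  rw [← Ideal.Quotient.eq_zero_iff_mem]
  simp

lemma exists_algHom_apply_ne_zero {F R : Type*} [Field F] [IsAlgClosed F] [CommRing R] [IsDomain R]
    [Algebra F R] [Algebra.FiniteType F R] {r : R} (hr : r ≠ 0) :
    ∃ χ : R →ₐ[F] F, χ r ≠ 0 := by
  have hJ : IsJacobsonRing R := isJacobsonRing_of_finiteType (A := F)
  have h : r ∉ (⊥ : Ideal R).jacobson := by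
    rw [hJ.out (Ideal.isPrime_bot).isRadical]
    simpa using hr
  rw [Ideal.jacobson, Submodule.mem_sInf] at h
  push Not at h
  obtain ⟨M, ⟨-, hM⟩, hrM⟩ := h
  obtain ⟨χ, hχ⟩ := exists_algHom_ker_eq (F := F) M
  exact ⟨χ, fun h => hrM ((hχ r).1 h)⟩

/-- Over an algebraically closed field, points of a dominated affine variety lift generically. -/
lemma exists_ne_zero_forall_algHom_lift {K C B : Type*} [Field K] [IsAlgClosed K] [CommRing C]
    [IsDomain C] [Algebra K C] [Algebra.FiniteType K C] [CommRing B] [IsDomain B] [Algebra K B]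
    [Algebra.FiniteType K B] (f : C →ₐ[K] B) (hf : Function.Injective f) :
    ∃ g : C, g ≠ 0 ∧ ∀ χ : C →ₐ[K] K, χ g ≠ 0 → ∃ ψ : B →ₐ[K] K, ∀ c, ψ (f c) = χ c := by
  have : IsNoetherianRing C := Algebra.FiniteType.isNoetherianRing K C
  have hft : (f : C →+* B).FiniteType := by
    let := (f : C →+* B).toAlgebra
    have : IsScalarTower K C B := IsScalarTower.of_algebraMap_eq fun k => (f.commutes k).symm
    exact Algebra.FiniteType.of_restrictScalars_finiteType K C B
  have hfp : (f : C →+* B).FinitePresentation := RingHom.FinitePresentation.of_finiteType.1 hft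
  obtain ⟨S, hS⟩ := PrimeSpectrum.exists_constructibleSetData_iff.2
    (PrimeSpectrum.isConstructible_range_comap hfp)
  have hbot : (⟨⊥, Ideal.isPrime_bot⟩ : PrimeSpectrum C) ∈ S.toSet := by
    rw [hS]
    refine ⟨⟨⊥, Ideal.isPrime_bot⟩, ?_⟩
    ext c
    simpa using map_eq_zero_iff f hf
  simp only [PrimeSpectrum.ConstructibleSetData.toSet, Set.mem_iUnion] at hbot
  obtain ⟨T, hT, hT'⟩ := hbot
  simp only [PrimeSpectrum.BasicConstructibleSetData.toSet, Set.mem_sdiff,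
    PrimeSpectrum.mem_zeroLocus, Set.singleton_subset_iff, SetLike.mem_coe, Ideal.mem_bot,
    Set.range_subset_iff] at hT'
  refine ⟨T.f, hT'.2, fun χ hχ => ?_⟩
  have hχp : (RingHom.ker χ).IsPrime := RingHom.ker_isPrime _
  have hχm : (RingHom.ker χ).IsMaximal :=
    RingHom.ker_isMaximal_of_surjective (χ : C →+* K) fun k => ⟨algebraMap K C k, by simp⟩
  have hmem : (⟨RingHom.ker χ, hχp⟩ : PrimeSpectrum C) ∈ S.toSet := by
    simp only [PrimeSpectrum.ConstructibleSetData.toSet, Set.mem_iUnion]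
    refine ⟨T, hT, ?_⟩
    simp only [PrimeSpectrum.BasicConstructibleSetData.toSet, Set.mem_sdiff,
      PrimeSpectrum.mem_zeroLocus, Set.singleton_subset_iff, SetLike.mem_coe,
      Set.range_subset_iff, RingHom.mem_ker]
    exact ⟨fun i => by rw [hT'.1 i, map_zero], hχ⟩
  rw [hS] at hmem
  obtain ⟨Q, hQ⟩ := hmem
  obtain ⟨M, hM, hQM⟩ := Ideal.exists_le_maximal Q.asIdeal Q.isPrime.ne_top
  obtain ⟨ψ, hψ⟩ := exists_algHom_ker_eq (F := K) M
  refine ⟨ψ, fun c => ?_⟩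
  have hc : c - algebraMap K C (χ c) ∈ Q.asIdeal.comap (f : C →+* B) := by
    have := congrArg PrimeSpectrum.asIdeal hQ
    rw [PrimeSpectrum.comap_asIdeal] at this
    rw [this]
    simp [RingHom.mem_ker]
  have := (hψ _).2 (hQM hc)
  simpa [sub_eq_zero] using this

lemma Derivation.exists_extension_of_formallyEtale {F P K : Type*} [CommRing F] [CommRing P]
    [CommRing K] [Algebra F P] [Algebra F K] [Algebra P K] [IsScalarTower F P K]
    [Algebra.FormallyEtale P K] (d : Derivation F P K) :
    ∃ D : Derivation F K K, ∀ p, D (algebraMap P K p) = d p := by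
  let e := KaehlerDifferential.tensorKaehlerEquivOfFormallyEtale F P K
  let l : K ⊗[P] Ω[P⁄F] →ₗ[K] K := d.liftKaehlerDifferential.liftBaseChange K
  refine ⟨(l ∘ₗ e.symm.toLinearMap).compDer (KaehlerDifferential.D F K), fun p => ?_⟩
  have : e (1 ⊗ₜ KaehlerDifferential.D F P p) = KaehlerDifferential.D F K (algebraMap P K p) := by
    simp [e]
  simp [← this, l]

lemma exists_derivation_apply_ne_zero {F K : Type*} [Field F] [Field K] [CharZero F] [Algebra F K]
    {x : K} (hx : Transcendental F x) : ∃ D : Derivation F K K, D x ≠ 0 := by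
  classical
  have hx' : AlgebraicIndepOn F id {x} :=
    (algebraicIndependent_singleton_iff (⟨x, rfl⟩ : ({x} : Set K))).2 hx
  obtain ⟨s, hxs, hs⟩ := exists_isTranscendenceBasis_superset hx'
  have hxs : x ∈ s := hxs rfl
  let φ : (MvPolynomial s F) →ₐ[F] K := MvPolynomial.aeval (fun i : s => (i : K))
  let : Algebra (MvPolynomial s F) K := φ.toRingHom.toAlgebra
  have hφ : ∀ p, algebraMap (MvPolynomial s F) K p = φ p := fun _ => rfl
  have : IsScalarTower F (MvPolynomial s F) K := IsScalarTower.of_algebraMap_eq fun r => (φ.commutes r).symm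
  have hinj : Function.Injective (algebraMap (MvPolynomial s F) K) := hs.1
  have : FaithfulSMul (MvPolynomial s F) K := (faithfulSMul_iff_algebraMap_injective (MvPolynomial s F) K).2 hinj
  have : Algebra.IsAlgebraic (Algebra.adjoin F (Set.range ((↑) : s → K))) K := hs.isAlgebraic
  have : Algebra.IsAlgebraic (MvPolynomial s F) K := by
    refine Algebra.IsAlgebraic.of_ringHom_of_comp_eq (S := Algebra.adjoin F (Set.range ((↑) : s → K)))
      hs.1.aevalEquiv (RingHom.id K) hs.1.aevalEquiv.surjective Function.injective_id ?_
    ext p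
    · change (hs.1.aevalEquiv (MvPolynomial.C p) : K) = φ (MvPolynomial.C p)
      simp [φ]
    · change (hs.1.aevalEquiv (MvPolynomial.X p) : K) = φ (MvPolynomial.X p)
      simp [φ]
  let : Algebra (FractionRing (MvPolynomial s F)) K := FractionRing.liftAlgebra (MvPolynomial s F) K
  have : IsScalarTower (MvPolynomial s F) (FractionRing (MvPolynomial s F)) K := FractionRing.isScalarTower_liftAlgebra (MvPolynomial s F) K
  have : Algebra.IsAlgebraic (FractionRing (MvPolynomial s F)) K := 
    (IsFractionRing.comap_isAlgebraic_iff (A := MvPolynomial s F)).1 inferInstance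
  have : CharZero (FractionRing (MvPolynomial s F)) := 
    charZero_of_injective_algebraMap (algebraMap F _).injective
  have : Algebra.FormallyEtale (FractionRing (MvPolynomial s F)) K := Algebra.FormallyEtale.of_isSeparable _ _
  have : Algebra.FormallyEtale (MvPolynomial s F) (FractionRing (MvPolynomial s F)) :=
    Algebra.FormallyEtale.of_isLocalization (nonZeroDivisors (MvPolynomial s F))
  have : Algebra.FormallyEtale (MvPolynomial s F) K := Algebra.FormallyEtale.comp (MvPolynomial s F) (FractionRing (MvPolynomial s F)) K
  obtain ⟨D, hD⟩ := Derivation.exists_extension_of_formallyEtale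
    (MvPolynomial.mkDerivation F (Pi.single ⟨x, hxs⟩ (1 : K)) : Derivation F (MvPolynomial s F) K)
  refine ⟨D, ?_⟩
  have h := hD (MvPolynomial.X ⟨x, hxs⟩)
  have hX : φ (MvPolynomial.X ⟨x, hxs⟩) = x := by simp [φ]
  rw [hφ, hX, MvPolynomial.mkDerivation_X] at h
  simp [h]

/-- A derivation of `K` extends to rational functions with prescribed values on the variables. -/
lemma exists_derivation_fractionRing_mvPolynomial {F K L σ : Type*} [Field F] [Field K]
    [Algebra F K] [Field L] [Algebra K L] [Algebra F L] [IsScalarTower F K L]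
    [Algebra (MvPolynomial σ K) L] [IsScalarTower K (MvPolynomial σ K) L]
    [IsScalarTower F (MvPolynomial σ K) L]
    [IsFractionRing (MvPolynomial σ K) L] (D : Derivation F K K) (ξ : σ → L) :
    ∃ D' : Derivation F L L, (∀ k : K, D' (algebraMap K L k) = algebraMap K L (D k)) ∧
      ∀ i, D' (algebraMap (MvPolynomial σ K) L (MvPolynomial.X i)) = ξ i := by
  let r : K →+* TrivSqZeroExt L L :=
    { toFun k := .inl (algebraMap K L k) + .inr (algebraMap K L (D k))
      map_one' := by ext <;> simp
      map_zero' := by ext <;> simp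
      map_add' a b := by ext <;> simp [Algebra.smul_def]
      map_mul' a b := by
        ext
        · simp
        · simp only [TrivSqZeroExt.snd_add, TrivSqZeroExt.snd_inl, TrivSqZeroExt.snd_inr,
            TrivSqZeroExt.snd_mul, TrivSqZeroExt.fst_add, TrivSqZeroExt.fst_inl,
            TrivSqZeroExt.fst_inr, zero_add, add_zero, op_smul_eq_smul, smul_eq_mul,
            Derivation.leibniz, map_add, map_mul] }
  let Φ : (MvPolynomial σ K) →+* TrivSqZeroExt L L := MvPolynomial.eval₂Hom r
    fun i => .inl (algebraMap (MvPolynomial σ K) L (MvPolynomial.X i)) + .inr (ξ i)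
  have hfst : ∀ p, (Φ p).fst = algebraMap (MvPolynomial σ K) L p := by
    intro p
    have : ((TrivSqZeroExt.fstHom L L L : _ →ₐ[L] L) : _ →+* L).comp Φ = algebraMap (MvPolynomial σ K) L := by
      apply MvPolynomial.ringHom_ext
      · intro k
        simp [Φ, r]
        exact (IsScalarTower.algebraMap_apply K (MvPolynomial σ K) L k)
      · intro i
        simp [Φ]
    exact congrArg (fun f => f p) this
  have hC : ∀ k, Φ (MvPolynomial.C k) = r k := fun k => MvPolynomial.eval₂Hom_C _ _ _
  let d : Derivation F (MvPolynomial σ K) L := Derivation.mk'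
    { toFun p := (Φ p).snd
      map_add' a b := by simp
      map_smul' c p := by
        have : c • p = MvPolynomial.C (algebraMap F K c) * p := by
          rw [← MvPolynomial.smul_eq_C_mul, algebraMap_smul]
        rw [this, map_mul, hC]
        simp [r, Algebra.smul_def, ← IsScalarTower.algebraMap_apply F K L] } fun a b => by
      change (Φ (a * b)).snd = a • (Φ b).snd + b • (Φ a).snd
      rw [map_mul, TrivSqZeroExt.snd_mul, hfst, hfst, op_smul_eq_smul, algebraMap_smul,
        algebraMap_smul]
  have : Algebra.FormallyEtale (MvPolynomial σ K) L := Algebra.FormallyEtale.of_isLocalization (nonZeroDivisors (MvPolynomial σ K))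
  obtain ⟨D', hD'⟩ := Derivation.exists_extension_of_formallyEtale d
  refine ⟨D', fun k => ?_, fun i => ?_⟩
  · rw [IsScalarTower.algebraMap_apply K (MvPolynomial σ K) L, hD']
    change (Φ (MvPolynomial.C k)).snd = _
    rw [hC]
    change 0 + algebraMap K L (D k) = _
    rw [zero_add]
  · rw [hD']
    change (Φ (MvPolynomial.X i)).snd = _
    simp [Φ]

lemma linearIndependent_of_derivation_extends {F K L ι : Type*} [Field F] [Field K] [Field L]
    [Algebra F K] [Algebra F L] [Algebra K L] [IsScalarTower F K L]
    (hconst : ∀ x : K, (∀ D : Derivation F K K, D x = 0) → x ∈ (algebraMap F K).range)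
    (b : ι → L) (hb : LinearIndependent F b)
    (hD : ∀ D : Derivation F K K, ∃ D' : Derivation F L L,
      (∀ k, D' (algebraMap K L k) = algebraMap K L (D k)) ∧ ∀ i, D' (b i) = 0) :
    LinearIndependent K b := by
  classical
  rw [linearIndependent_iff]
  intro l
  induction h : l.support.card using Nat.strong_induction_on generalizing l with
  | _ m ih =>
    subst h
    intro hl
    by_contra hl0
    obtain ⟨i, hi⟩ := Finsupp.support_nonempty_iff.2 hl0
    rw [Finsupp.mem_support_iff] at hi
    let c := (l i)⁻¹ • l
    have hc0 : Finsupp.linearCombination K b c = 0 := by simp [c, hl]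
    have hci : c i = 1 := by simp [c, hi]
    have hDc : ∀ (D : Derivation F K K) j, D (c j) = 0 := by
      intro D j
      obtain ⟨D', hD', hD'b⟩ := hD D
      let e : ι →₀ K := c.mapRange D (map_zero D)
      have he : Finsupp.linearCombination K b e = 0 := by
        have := congrArg D' hc0
        rw [map_zero, Finsupp.linearCombination_apply, Finsupp.sum, map_sum] at this
        rw [Finsupp.linearCombination_apply, Finsupp.sum_mapRange_index (by simp), Finsupp.sum,
          ← this]
        refine Finset.sum_congr rfl fun j _ => ?_
        simp [Algebra.smul_def, hD', hD'b, mul_comm]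
      have hlt : e.support.card < l.support.card := by
        apply Finset.card_lt_card
        refine (Finset.ssubset_iff_of_subset ?_).2 ⟨i, by simpa using hi, by simp [e, hci]⟩
        intro k hk
        contrapose! hk
        simp at hk
        simp [e, c, hk]
      have := ih _ hlt e rfl he
      exact DFunLike.congr_fun this j
    choose f hf using fun j => hconst (c j) (fun D => hDc D j)
    have hfin : (Function.support f).Finite := by
      refine c.support.finite_toSet.subset fun j hj => ?_
      simp only [Finset.mem_coe, Finsupp.mem_support_iff, ← hf]
      simpa using hj
    let f' : ι →₀ F := Finsupp.ofSupportFinite f hfin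
    have hcf : c = f'.mapRange (algebraMap F K) (map_zero _) := by
      ext j; simp [f', Finsupp.ofSupportFinite_coe, hf]
    have : Finsupp.linearCombination F b f' = 0 := by
      rw [← hc0, hcf, Finsupp.linearCombination_apply, Finsupp.linearCombination_apply,
        Finsupp.sum_mapRange_index (by simp)]
      simp
    have h0 := linearIndependent_iff.1 hb f' this
    simp [hcf, h0] at hci

/-- If enough derivations of `L` vanish on `w`, then `w` may be specialised to constants. -/
lemma exists_algHom_apply_mem_range_of_derivation {F K L ι : Type*} [Field F] [IsAlgClosed F]
    [CharZero F] [Field K] [IsAlgClosed K] [Field L] [Algebra F K] [Algebra F L] [Algebra K L]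
    [IsScalarTower F K L] [Finite ι] (w : ι → L) (B : Subalgebra K L) (hB : B.FG)
    (hw : ∀ i, w i ∈ B)
    (hD : ∀ D : Derivation F K K, ∃ D' : Derivation F L L,
      (∀ k, D' (algebraMap K L k) = algebraMap K L (D k)) ∧ ∀ i, D' (w i) = 0) :
    ∃ (ψ : B →ₐ[K] K) (y : ι → F), ∀ i, ψ ⟨w i, hw i⟩ = algebraMap F K (y i) := by
  classical
  let R := Algebra.adjoin F (Set.range w)
  have hwR : ∀ i, w i ∈ R := fun i => Algebra.subset_adjoin ⟨i, rfl⟩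
  have : Algebra.FiniteType F R :=
    R.fg_iff_finiteType.1 (Subalgebra.fg_def.2 ⟨_, Set.finite_range w, rfl⟩)
  have : Algebra.FiniteType K B := B.fg_iff_finiteType.1 hB
  let b := Module.Basis.ofVectorSpace F R
  have hb : LinearIndependent K fun i => (b i : L) := by
    refine linearIndependent_of_derivation_extends (F := F) (fun x hx => ?_) _
      (b.linearIndependent.map' R.val.toLinearMap
        (LinearMap.ker_eq_bot.2 Subtype.val_injective)) fun D => ?_
    · by_contra hxF
      have htr : Transcendental F x := fun h =>
        hxF (h.isIntegral.mem_range_algebraMap_of_minpoly_splits (IsAlgClosed.splits _))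
      obtain ⟨D, hD⟩ := exists_derivation_apply_ne_zero htr
      exact hD (hx D)
    · obtain ⟨D', h1, h2⟩ := hD D
      refine ⟨D', h1, fun i => ?_⟩
      have : ∀ x ∈ R, D' x = 0 := by
        intro x hx
        induction hx using Algebra.adjoin_induction with
        | mem x hx => obtain ⟨i, rfl⟩ := hx; exact h2 i
        | algebraMap r => exact D'.map_algebraMap r
        | add x y _ _ hx hy => rw [map_add, hx, hy, add_zero]
        | mul x y _ _ hx hy => rw [D'.leibniz, hx, hy, smul_zero, smul_zero, add_zero]
      exact this _ (b i).2
  let θ : K ⊗[F] R →ₐ[K] L :=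
    Algebra.TensorProduct.lift (Algebra.ofId K L) R.val fun _ _ => Commute.all _ _
  have hθ : ∀ k (r : R), θ (k ⊗ₜ r) = algebraMap K L k * r := fun k r => by
    simp [θ, Algebra.ofId_apply]
  have hθinj : Function.Injective θ := by
    rw [injective_iff_map_eq_zero]
    intro c hc
    have hcb : ∀ i, θ (b.baseChange K i) = b i := fun i => by simp [hθ]
    rw [← (b.baseChange K).linearCombination_repr c] at hc ⊢
    have h := Finsupp.apply_linearCombination K θ.toLinearMap (b.baseChange K)
      ((b.baseChange K).repr c)
    rw [AlgHom.toLinearMap_apply, hc] at h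
    have hfun : (θ.toLinearMap ∘ (b.baseChange K)) = fun i => (b i : L) := funext hcb
    rw [hfun] at h
    rw [linearIndependent_iff.1 hb _ h.symm, map_zero]
  have hRB : ∀ r : R, (r : L) ∈ B := by
    have : R ≤ B.restrictScalars F := Algebra.adjoin_le (by rintro _ ⟨i, rfl⟩; exact hw i)
    exact fun r => this r.2
  have hθB : ∀ c, θ c ∈ B := by
    intro c
    induction c using TensorProduct.induction_on with
    | zero => rw [map_zero]; exact B.zero_mem
    | tmul k r => rw [hθ]; exact B.mul_mem (B.algebraMap_mem k) (hRB r)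
    | add x y hx hy => rw [map_add]; exact B.add_mem hx hy
  have : IsDomain (K ⊗[F] R) := hθinj.isDomain θ.toRingHom
  let θB : K ⊗[F] R →ₐ[K] B := θ.codRestrict B hθB
  have hθBinj : Function.Injective θB := fun x y h => hθinj (congrArg Subtype.val h)
  obtain ⟨g, hg, hlift⟩ := exists_ne_zero_forall_algHom_lift θB hθBinj
  let 𝓑 := Module.Basis.ofVectorSpace F K
  let e := TensorProduct.equivFinsuppOfBasisLeft (N := R) 𝓑
  have heg : e g ≠ 0 := by simpa using hg
  obtain ⟨j, hj⟩ := Finsupp.ne_iff.1 heg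
  obtain ⟨χ, hχ⟩ := exists_algHom_apply_ne_zero (F := F) hj
  let χK : K ⊗[F] R →ₐ[K] K :=
    Algebra.TensorProduct.lift (AlgHom.id K K) ((Algebra.ofId F K).comp χ)
      fun _ _ => Commute.all _ _
  have hχK : ∀ k r, χK (k ⊗ₜ r) = χ r • k := fun k r => by
    simp [χK, Algebra.ofId_apply, Algebra.smul_def, mul_comm]
  have hrepr : ∀ c, 𝓑.repr (χK c) j = χ (e c j) := by
    intro c
    induction c using TensorProduct.induction_on with
    | zero => simp
    | tmul k r => simp [hχK, e, mul_comm]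
    | add x y hx hy => simp [hx, hy]
  obtain ⟨ψ, hψ⟩ := hlift χK fun h => hχ (by rw [← hrepr, h]; simp)
  refine ⟨ψ, fun i => χ ⟨w i, hwR i⟩, fun i => ?_⟩
  have h := hψ (1 ⊗ₜ ⟨w i, hwR i⟩)
  rw [hχK, ← Algebra.algebraMap_eq_smul_one] at h
  rw [← h]
  congr 1
  apply Subtype.ext
  change _ = θ _
  simp [hθ]

/-- The bilinear product on `n → R` with structure constants `v`. -/
def structureMul {n R : Type*} [Fintype n] [CommSemiring R] (v : n → n → n → R) (x y : n → R) :
    n → R :=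
  fun k => ∑ i, ∑ j, v i j k * x i * y j

lemma structureMul_sum_left {n ι R : Type*} [Fintype n] [CommSemiring R] (v : n → n → n → R)
    (s : Finset ι) (c : ι → R) (x : ι → n → R) (y : n → R) (k : n) :
    structureMul v (fun i => ∑ l ∈ s, c l * x l i) y k =
      ∑ l ∈ s, c l * structureMul v (x l) y k := by
  simp only [structureMul, Finset.mul_sum, Finset.sum_mul]
  rw [Finset.sum_congr rfl fun _ _ => Finset.sum_comm, Finset.sum_comm]
  simp only [mul_assoc, mul_left_comm]

lemma structureMul_sum_right {n ι R : Type*} [Fintype n] [CommSemiring R] (v : n → n → n → R)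
    (s : Finset ι) (c : ι → R) (x : n → R) (y : ι → n → R) (k : n) :
    structureMul v x (fun i => ∑ l ∈ s, c l * y l i) k =
      ∑ l ∈ s, c l * structureMul v x (y l) k := by
  simp only [structureMul, Finset.mul_sum]
  rw [Finset.sum_congr rfl fun _ _ => Finset.sum_comm, Finset.sum_comm]
  simp only [mul_left_comm]

lemma map_structureMul {n R S : Type*} [Fintype n] [CommSemiring R] [CommSemiring S]
    (f : R →+* S) (v : n → n → n → R) (x y : n → R) (k : n) :
    f (structureMul v x y k) =
      structureMul (fun i j k => f (v i j k)) (fun i => f (x i)) (fun i => f (y i)) k := by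
  simp [structureMul]

lemma Derivation.map_structureMul {n F R : Type*} [Fintype n] [CommRing F] [CommRing R]
    [Algebra F R] (D : Derivation F R R) (v : n → n → n → R) (x y : n → R) (k : n) :
    D (structureMul v x y k) = structureMul (fun i j k => D (v i j k)) x y k +
      structureMul v (fun i => D (x i)) y k + structureMul v x (fun i => D (y i)) k := by
  simp only [structureMul, map_sum, D.leibniz, smul_eq_mul, ← Finset.sum_add_distrib]
  refine Finset.sum_congr rfl fun i _ => Finset.sum_congr rfl fun j _ => ?_
  ring

/-- Derivative of structure constants with respect to a moving basis. -/
lemma Derivation.apply_structureConstants {n F K : Type*} [Fintype n] [DecidableEq n] [Field F]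
    [Field K] [Algebra F K] (a : n → n → n → F) (v : n → n → n → K) {P Q : Matrix n n K}
    (hPQ : P * Q = 1)
    (hv : ∀ i j k, structureMul (fun i j k => algebraMap F K (a i j k)) (P i) (P j) k =
      ∑ l, v i j l * P l k) (D : Derivation F K K) (i j k : n) :
    D (v i j k) + ∑ l, v i j l * (P.map D * Q) l k =
      ∑ l, (P.map D * Q) i l * v l j k + ∑ l, (P.map D * Q) j l * v i l k := by
  set ξ := P.map D * Q
  have hξ : ∀ i k, D (P i k) = ∑ l, ξ i l * P l k := by
    intro i k
    have : P.map D = ξ * P := by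
      simp only [ξ, Matrix.mul_assoc, mul_eq_one_comm.1 hPQ, Matrix.mul_one]
    exact congrFun₂ this i k
  have h : ∀ k, ∑ l, (D (v i j l) + ∑ e, v i j e * ξ e l -
      (∑ e, ξ i e * v e j l + ∑ e, ξ j e * v i e l)) * P l k = 0 := by
    intro k
    have h1 := congrArg D (hv i j k)
    rw [D.map_structureMul, funext (hξ i), funext (hξ j), structureMul_sum_left _ _ (ξ i) P,
      structureMul_sum_right _ _ (ξ j) _ P] at h1
    simp only [hv, Derivation.map_algebraMap, map_sum, D.leibniz, smul_eq_mul, hξ] at h1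
    have h0 : structureMul (fun _ _ _ => (0 : K)) (P i) (P j) k = 0 := by simp [structureMul]
    rw [h0, Finset.sum_add_distrib] at h1
    simp only [sub_mul, add_mul, Finset.sum_mul, Finset.sum_sub_distrib, Finset.sum_add_distrib]
    simp only [Finset.mul_sum, ← mul_assoc] at h1
    rw [Finset.sum_comm (f := fun x i_1 => v i j i_1 * _ * _),
      Finset.sum_comm (f := fun x i_1 => ξ i i_1 * _ * _),
      Finset.sum_comm (f := fun x i_1 => ξ j i_1 * _ * _)]
    have h2 : ∑ x, P x k * D (v i j x) = ∑ x, D (v i j x) * P x k :=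
      Finset.sum_congr rfl fun _ _ => mul_comm _ _
    rw [h2] at h1
    linear_combination -h1
  have h2 : Matrix.vecMul (fun l => (D (v i j l) + ∑ e, v i j e * ξ e l -
      (∑ e, ξ i e * v e j l + ∑ e, ξ j e * v i e l))) P = 0 := funext h
  have h3 := congrArg (Matrix.vecMul · Q) h2
  simp only [Matrix.vecMul_vecMul, hPQ, Matrix.vecMul_one, Matrix.zero_vecMul] at h3
  exact sub_eq_zero.1 (congrFun h3 k)

/-- The degree-zero part of a matrix also computes the derivative of graded structure constants. -/
lemma Derivation.apply_graded_structureConstants {n F K H : Type*} [Fintype n] [DecidableEq n]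
    [Field F] [Field K] [Algebra F K] [CommGroup H] [DecidableEq H] (d : n → H)
    (a : n → n → n → F) (v : n → n → n → K)
    (hd : ∀ i j k, d i * d j ≠ d k → v i j k = 0) {P Q : Matrix n n K} (hPQ : P * Q = 1)
    (hv : ∀ i j k, structureMul (fun i j k => algebraMap F K (a i j k)) (P i) (P j) k =
      ∑ l, v i j l * P l k) (D : Derivation F K K) :
    ∃ ξ : Matrix n n K, (∀ i j, d i ≠ d j → ξ i j = 0) ∧ ∀ i j k,
      D (v i j k) + ∑ l, v i j l * ξ l k = ∑ l, ξ i l * v l j k + ∑ l, ξ j l * v i l k := by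
  refine ⟨fun i j => if d i = d j then (P.map D * Q) i j else 0, fun i j h => if_neg h,
    fun i j k => ?_⟩
  by_cases h : d i * d j = d k
  · convert D.apply_structureConstants a v hPQ hv i j k using 3 with l _ l _ l _
    · dsimp only
      split_ifs with hl
      · rfl
      · rw [hd i j l fun h' => hl (h'.symm.trans h), zero_mul, zero_mul]
    · dsimp only
      split_ifs with hl
      · rfl
      · rw [hd l j k fun h' => hl (mul_right_cancel (h.trans h'.symm)), mul_zero, mul_zero]
    · dsimp only
      split_ifs with hl
      · rfl
      · rw [hd i l k fun h' => hl (mul_left_cancel (h.trans h'.symm)), mul_zero, mul_zero]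
  · rw [hd i j k h, map_zero, zero_add, Finset.sum_eq_zero, Finset.sum_eq_zero,
      Finset.sum_eq_zero, add_zero]
    · intro l _
      dsimp only
      split_ifs with hl
      · rw [hd i l k fun h' => h (by rw [hl, h']), mul_zero]
      · rw [zero_mul]
    · intro l _
      dsimp only
      split_ifs with hl
      · rw [hd l j k fun h' => h (by rw [hl, h']), mul_zero]
      · rw [zero_mul]
    · intro l _
      dsimp only
      split_ifs with hl
      · rw [hd i j l fun h' => h (by rw [h', hl]), zero_mul]
      · rw [mul_zero]

/-- A semilinear map acting on basis vectors through `ξ` satisfies the Leibniz rule as soon as it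
does so on the structure constants. -/
lemma Derivation.leibniz_structureMul {n F R : Type*} [Fintype n] [CommRing F] [CommRing R]
    [Algebra F R] (D : Derivation F R R) (v : n → n → n → R) (ξ : n → n → R)
    (h : ∀ i j k,
      D (v i j k) + ∑ l, v i j l * ξ l k = ∑ l, ξ i l * v l j k + ∑ l, ξ j l * v i l k)
    (x y : n → R) (k : n) :
    D (structureMul v x y k) + ∑ l, structureMul v x y l * ξ l k =
      structureMul v (fun i => D (x i) + ∑ l, x l * ξ l i) y k +
        structureMul v x (fun i => D (y i) + ∑ l, y l * ξ l i) k := by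
  have h1 : structureMul v (fun i => D (x i) + ∑ l, x l * ξ l i) y k =
      structureMul v (fun i => D (x i)) y k + ∑ i, ∑ j, (∑ l, ξ i l * v l j k) * x i * y j := by
    simp only [structureMul, mul_add, add_mul, Finset.sum_add_distrib]
    congr 1
    simp only [Finset.mul_sum, Finset.sum_mul]
    rw [Finset.sum_congr rfl fun _ _ => Finset.sum_comm, Finset.sum_comm]
    refine Finset.sum_congr rfl fun _ _ => ?_
    rw [Finset.sum_comm]
    exact Finset.sum_congr rfl fun _ _ => Finset.sum_congr rfl fun _ _ => by ring
  have h2 : structureMul v x (fun i => D (y i) + ∑ l, y l * ξ l i) k =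
      structureMul v x (fun i => D (y i)) k + ∑ i, ∑ j, (∑ l, ξ j l * v i l k) * x i * y j := by
    simp only [structureMul, mul_add, Finset.sum_add_distrib]
    congr 1
    refine Finset.sum_congr rfl fun _ _ => ?_
    simp only [Finset.mul_sum, Finset.sum_mul]
    rw [Finset.sum_comm]
    exact Finset.sum_congr rfl fun _ _ => Finset.sum_congr rfl fun _ _ => by ring
  have h3 : ∑ l, structureMul v x y l * ξ l k =
      ∑ i, ∑ j, (∑ l, v i j l * ξ l k) * x i * y j := by
    simp only [structureMul, Finset.sum_mul]
    rw [Finset.sum_comm]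
    refine Finset.sum_congr rfl fun _ _ => ?_
    rw [Finset.sum_comm]
    exact Finset.sum_congr rfl fun _ _ => Finset.sum_congr rfl fun _ _ => by ring
  have h4 : structureMul (fun i j k => D (v i j k)) x y k =
      ∑ i, ∑ j, D (v i j k) * x i * y j := rfl
  have h5 : ∑ i, ∑ j, D (v i j k) * x i * y j + ∑ i, ∑ j, (∑ l, v i j l * ξ l k) * x i * y j =
      ∑ i, ∑ j, (∑ l, ξ i l * v l j k) * x i * y j +
        ∑ i, ∑ j, (∑ l, ξ j l * v i l k) * x i * y j := by
    simp only [← Finset.sum_add_distrib]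
    refine Finset.sum_congr rfl fun i _ => Finset.sum_congr rfl fun j _ => ?_
    linear_combination (x i * y j) * h i j k
  rw [D.map_structureMul, h1, h2, h3, h4]
  linear_combination h5

/-- The structure constants of a basis annihilated by a semilinear derivation are constant. -/
lemma Derivation.structureConstants_eq_zero_of_parallel {n F R : Type*} [Fintype n]
    [DecidableEq n] [CommRing F] [CommRing R] [Algebra F R] (D : Derivation F R R)
    (v : n → n → n → R) (ξ : n → n → R)
    (hξ : ∀ i j k,
      D (v i j k) + ∑ l, v i j l * ξ l k = ∑ l, ξ i l * v l j k + ∑ l, ξ j l * v i l k)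
    {h g : Matrix n n R} (hg : h * g = 1) (hD : ∀ i j, D (h i j) + ∑ l, h i l * ξ l j = 0)
    (w : n → n → n → R) (hw : ∀ i j k, structureMul v (h i) (h j) k = ∑ l, w i j l * h l k)
    (i j l : n) : D (w i j l) = 0 := by
  have h1 : ∀ k, ∑ l, D (w i j l) * h l k = 0 := by
    intro k
    have h2 := D.leibniz_structureMul v ξ hξ (h i) (h j) k
    simp only [hD] at h2
    have h3 : structureMul v (fun _ => 0) (h j) k = 0 := by simp [structureMul]
    have h4 : structureMul v (h i) (fun _ => 0) k = 0 := by simp [structureMul]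
    have h5 : ∑ e, (∑ l, w i j l * h l e) * ξ e k = ∑ l, w i j l * ∑ e, h l e * ξ e k := by
      simp only [Finset.sum_mul, Finset.mul_sum, mul_assoc]
      exact Finset.sum_comm
    rw [h3, h4, add_zero] at h2
    simp only [hw, map_sum, D.leibniz, smul_eq_mul] at h2
    rw [h5, ← Finset.sum_add_distrib] at h2
    rw [← h2]
    refine Finset.sum_congr rfl fun l _ => ?_
    linear_combination (-w i j l) * hD l k
  have h2 : Matrix.vecMul (fun l => D (w i j l)) h = 0 := funext h1
  have h3 := congrArg (Matrix.vecMul · g) h2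
  simp only [Matrix.vecMul_vecMul, hg, Matrix.vecMul_one, Matrix.zero_vecMul] at h3
  exact congrFun h3 l

/-- A homogeneous change of basis with structure constants in the base field. -/
lemma exists_homogeneous_basis_structureConstants_descend {F K n H : Type*} [Fintype n]
    [DecidableEq n] [Field F] [IsAlgClosed F] [CharZero F] [Field K] [IsAlgClosed K] [Algebra F K]
    [DecidableEq H] (d : n → H) (v : n → n → n → K)
    (hv : ∀ D : Derivation F K K, ∃ ξ : Matrix n n K, (∀ i j, d i ≠ d j → ξ i j = 0) ∧ ∀ i j k,
      D (v i j k) + ∑ l, v i j l * ξ l k = ∑ l, ξ i l * v l j k + ∑ l, ξ j l * v i l k) :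
    ∃ (h g : Matrix n n K) (y : n → n → n → F), h * g = 1 ∧ (∀ i j, d i ≠ d j → h i j = 0) ∧
      ∀ i j k, structureMul v (h i) (h j) k = ∑ l, algebraMap F K (y i j l) * h l k := by
  let S := MvPolynomial (n × n) K
  let L := FractionRing S
  let h₀ : Matrix n n S := fun i j => if d i = d j then MvPolynomial.X (i, j) else 0
  let h : Matrix n n L := h₀.map (algebraMap S L)
  have hX : ∀ i j, d i = d j → h i j = algebraMap S L (MvPolynomial.X (i, j)) :=
    fun _ _ hij => congrArg (algebraMap S L) (if_pos hij)
  have h0 : ∀ i j, d i ≠ d j → h i j = 0 := fun _ _ hij =>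
    (congrArg (algebraMap S L) (if_neg hij)).trans (map_zero _)
  have hdet : IsUnit h.det := by
    rw [isUnit_iff_ne_zero]
    have : h.det = algebraMap S L h₀.det := ((algebraMap S L).map_det h₀).symm
    rw [this, Ne, IsFractionRing.to_map_eq_zero_iff]
    intro hz
    have h1 := congrArg (MvPolynomial.eval fun p : n × n => if p.1 = p.2 then (1 : K) else 0) hz
    rw [RingHom.map_det, map_zero] at h1
    have h2 : (MvPolynomial.eval fun p : n × n => if p.1 = p.2 then (1 : K) else 0).mapMatrix h₀ =
        1 := by
      ext i j
      rw [RingHom.mapMatrix_apply, Matrix.map_apply, Matrix.one_apply]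
      by_cases hij : i = j
      · simp [h₀, hij]
      · by_cases hd : d i = d j <;> simp [h₀, hij, hd]
    rw [h2, Matrix.det_one] at h1
    exact one_ne_zero h1
  have hinv : h * h⁻¹ = 1 := Matrix.mul_nonsing_inv h hdet
  let vL : n → n → n → L := fun i j k => algebraMap K L (v i j k)
  let w : n × n × n → L := fun p =>
    ∑ k, structureMul vL (h p.1) (h p.2.1) k * h⁻¹ k p.2.2
  have hw : ∀ i j k, structureMul vL (h i) (h j) k = ∑ l, w (i, j, l) * h l k := by
    intro i j k
    have : Matrix.vecMul (Matrix.vecMul (structureMul vL (h i) (h j)) h⁻¹) h =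
        structureMul vL (h i) (h j) := by
      rw [Matrix.vecMul_vecMul, mul_eq_one_comm.1 hinv, Matrix.vecMul_one]
    exact (congrFun this k).symm
  let gens : (n × n) ⊕ (n × n) ⊕ (n × n × n) → L :=
    Sum.elim (fun p => h p.1 p.2) (Sum.elim (fun p => h⁻¹ p.1 p.2) w)
  let B := Algebra.adjoin K (Set.range gens)
  have hB : ∀ i, gens i ∈ B := fun i => Algebra.subset_adjoin ⟨i, rfl⟩
  obtain ⟨ψ, y, hψ⟩ := exists_algHom_apply_mem_range_of_derivation (F := F) w B
    (Subalgebra.fg_def.2 ⟨_, Set.finite_range gens, rfl⟩) (fun i => hB (.inr (.inr i))) (by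
    intro D
    obtain ⟨ξ, hξ0, hξ⟩ := hv D
    let ξL : n → n → L := fun i j => algebraMap K L (ξ i j)
    obtain ⟨D', hD', hDX⟩ := exists_derivation_fractionRing_mvPolynomial (L := L) D
      (fun p : n × n => -∑ l, h p.1 l * ξL l p.2)
    have hDh : ∀ i j, D' (h i j) + ∑ l, h i l * ξL l j = 0 := by
      intro i j
      by_cases hij : d i = d j
      · rw [hX i j hij, hDX, neg_add_cancel]
      · rw [h0 i j hij, map_zero, zero_add]
        refine Finset.sum_eq_zero fun l _ => ?_
        by_cases hil : d i = d l
        · simp [ξL, hξ0 l j fun hl => hij (hil.trans hl)]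
        · rw [h0 i l hil, zero_mul]
    have hξL : ∀ i j k, D' (vL i j k) + ∑ l, vL i j l * ξL l k =
        ∑ l, ξL i l * vL l j k + ∑ l, ξL j l * vL i l k := by
      intro i j k
      have := congrArg (algebraMap K L) (hξ i j k)
      simpa only [map_add, map_sum, map_mul, ← hD'] using this
    refine ⟨D', hD', ?_⟩
    rintro ⟨i, j, l⟩
    exact D'.structureConstants_eq_zero_of_parallel vL ξL hξL hinv hDh (fun i j l => w (i, j, l))
      hw i j l)
  let hB' : Matrix n n B := fun i j => ⟨h i j, hB (.inl (i, j))⟩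
  let gB : Matrix n n B := fun i j => ⟨h⁻¹ i j, hB (.inr (.inl (i, j)))⟩
  have hinj : Function.Injective (algebraMap B L) := Subtype.val_injective
  refine ⟨hB'.map ψ, gB.map ψ, fun i j l => y (i, j, l), ?_, fun i j hij => ?_, fun i j k => ?_⟩
  · have : hB' * gB = 1 := by
      ext i j
      have := congrFun₂ hinv i j
      rw [Matrix.mul_apply, Matrix.one_apply] at this
      rw [Matrix.mul_apply, Matrix.one_apply, AddSubmonoidClass.coe_finsetSum]
      simp only [MulMemClass.coe_mul, hB', gB, this]
      split_ifs <;> rfl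
    rw [← Matrix.map_mul, this, Matrix.map_one _ (map_zero _) (map_one _)]
  · have : hB' i j = 0 := Subtype.ext (h0 i j hij)
    rw [Matrix.map_apply, this, map_zero]
  · have h1 : structureMul (fun i j k => algebraMap K B (v i j k)) (hB' i) (hB' j) k =
        ∑ l, ⟨w (i, j, l), hB (.inr (.inr (i, j, l)))⟩ * hB' l k := by
      apply hinj
      rw [map_structureMul, map_sum]
      exact hw i j k
    have h2 := congrArg ψ.toRingHom h1
    rw [map_structureMul, map_sum] at h2
    simp only [AlgHom.toRingHom_eq_coe, RingHom.coe_coe, AlgHom.commutes, map_mul,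
      Algebra.algebraMap_self_apply] at h2
    exact h2.trans (Finset.sum_congr rfl fun l _ => by rw [← hψ]; rfl)

/-- Descent to `F` of a basis whose structure constants lie in `F`. -/
lemma exists_matrix_structureMul_descend {F K n : Type*} [Fintype n] [DecidableEq n] [Field F]
    [IsAlgClosed F] [Field K] [Algebra F K] (a y : n → n → n → F) {U V : Matrix n n K}
    (hUV : U * V = 1)
    (hU : ∀ i j k, structureMul (fun i j k => algebraMap F K (a i j k)) (U i) (U j) k =
      ∑ l, algebraMap F K (y i j l) * U l k) :
    ∃ P Q : Matrix n n F, P * Q = 1 ∧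
      ∀ i j k, structureMul a (P i) (P j) k = ∑ l, y i j l * P l k := by
  let gens : (n × n) ⊕ (n × n) → K := Sum.elim (fun p => U p.1 p.2) (fun p => V p.1 p.2)
  let R := Algebra.adjoin F (Set.range gens)
  have hR : ∀ i, gens i ∈ R := fun i => Algebra.subset_adjoin ⟨i, rfl⟩
  have : Algebra.FiniteType F R :=
    R.fg_iff_finiteType.1 (Subalgebra.fg_def.2 ⟨_, Set.finite_range gens, rfl⟩)
  obtain ⟨χ, -⟩ := exists_algHom_apply_ne_zero (F := F) (one_ne_zero (α := R))
  let UR : Matrix n n R := fun i j => ⟨U i j, hR (.inl (i, j))⟩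
  let VR : Matrix n n R := fun i j => ⟨V i j, hR (.inr (i, j))⟩
  have hinj : Function.Injective (algebraMap R K) := Subtype.val_injective
  refine ⟨UR.map χ, VR.map χ, ?_, fun i j k => ?_⟩
  · have : UR * VR = 1 := by
      apply Matrix.map_injective hinj
      dsimp only
      rw [Matrix.map_mul, Matrix.map_one _ (map_zero _) (map_one _)]
      exact hUV
    rw [← Matrix.map_mul, this, Matrix.map_one _ (map_zero _) (map_one _)]
  · have h1 : structureMul (fun i j k => algebraMap F R (a i j k)) (UR i) (UR j) k =
        ∑ l, algebraMap F R (y i j l) * UR l k := by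
      apply hinj
      rw [map_structureMul, map_sum]
      exact hU i j k
    have h2 := congrArg χ.toRingHom h1
    rw [map_structureMul, map_sum] at h2
    simp only [AlgHom.toRingHom_eq_coe, RingHom.coe_coe, AlgHom.commutes, map_mul,
      Algebra.algebraMap_self_apply] at h2
    exact h2

section StructureConstants

variable {n R A : Type*} [Fintype n] [CommRing R] [NonUnitalNonAssocRing A] [Module R A]
  [SMulCommClass R A A] [IsScalarTower R A A]

lemma Module.Basis.sum_smul_mul_sum_smul (b : Module.Basis n R A) (x y : n → R) :
    (∑ i, x i • b i) * ∑ j, y j • b j =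
      ∑ k, structureMul (fun i j k => b.repr (b i * b j) k) x y k • b k := by
  simp only [structureMul, Finset.sum_mul_sum, Finset.sum_smul, smul_mul_smul_comm]
  symm
  rw [Finset.sum_comm]
  refine Finset.sum_congr rfl fun i _ => ?_
  rw [Finset.sum_comm]
  refine Finset.sum_congr rfl fun j _ => ?_
  symm
  nth_rewrite 1 [← b.sum_repr (b i * b j)]
  rw [Finset.smul_sum]
  refine Finset.sum_congr rfl fun k _ => ?_
  rw [smul_smul]
  congr 1
  ring

lemma Module.Basis.repr_mul (b : Module.Basis n R A) (x y : A) (k : n) :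
    b.repr (x * y) k =
      structureMul (fun i j k => b.repr (b i * b j) k) (b.repr x) (b.repr y) k := by
  classical
  nth_rewrite 1 [← b.sum_repr x, ← b.sum_repr y]
  rw [b.sum_smul_mul_sum_smul, b.repr_sum_self]

/-- A linear map matching bases with the same structure constants is multiplicative. -/
lemma Module.Basis.equiv_mul (b c : Module.Basis n R A)
    (h : ∀ i j k, b.repr (b i * b j) k = c.repr (c i * c j) k) (x y : A) :
    b.equiv c (Equiv.refl n) (x * y) =
      b.equiv c (Equiv.refl n) x * b.equiv c (Equiv.refl n) y := by
  have hrepr : ∀ z k, c.repr (b.equiv c (Equiv.refl n) z) k = b.repr z k := fun z k => by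
    simp [Module.Basis.equiv]
  refine c.ext_elem fun k => ?_
  rw [c.repr_mul, hrepr, b.repr_mul]
  simp only [structureMul, h, hrepr]

end StructureConstants

section Grading

variable {n F A G : Type*} [Field F] [NonUnitalNonAssocRing A] [Module F A]

lemma repr_eq_zero_of_mem_of_ne {comp : G → Submodule F A} (hc : iSupIndep comp)
    (b : Module.Basis n F A) (d : n → G) (hb : ∀ i, b i ∈ comp (d i)) {g : G} {x : A}
    (hx : x ∈ comp g) {k : n} (hk : d k ≠ g) : b.repr x k = 0 := by
  classical
  let s := (b.repr x).support
  have hsum : ∑ i ∈ s with d i = g, b.repr x i • b i + ∑ i ∈ s with ¬ d i = g, b.repr x i • b i =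
      x := by
    rw [Finset.sum_filter_add_sum_filter_not]
    exact b.linearCombination_repr x
  have h1 : ∑ i ∈ s with ¬ d i = g, b.repr x i • b i ∈ comp g := by
    rw [← eq_sub_iff_add_eq'] at hsum
    rw [hsum]
    refine sub_mem hx (sum_mem fun i hi => ?_)
    rw [← (Finset.mem_filter.1 hi).2]
    exact Submodule.smul_mem _ _ (hb i)
  have h2 : ∑ i ∈ s with ¬ d i = g, b.repr x i • b i ∈ ⨆ j, ⨆ _ : j ≠ g, comp j :=
    sum_mem fun i hi => Submodule.mem_iSup_of_mem (d i)
      (Submodule.mem_iSup_of_mem (Finset.mem_filter.1 hi).2 (Submodule.smul_mem _ _ (hb i)))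
  have h3 := Submodule.disjoint_def.1 (hc g) _ h1 h2
  by_contra hk0
  exact hk0 (linearIndependent_iff'.1 b.linearIndependent _ _ h3 k
    (Finset.mem_filter.2 ⟨Finsupp.mem_support_iff.2 hk0, hk⟩))

lemma eq_span_of_homogeneous_basis {comp : G → Submodule F A} (hc : iSupIndep comp)
    (b : Module.Basis n F A) (d : n → G) (hb : ∀ i, b i ∈ comp (d i)) (g : G) :
    comp g = Submodule.span F (b '' (d ⁻¹' {g})) := by
  apply le_antisymm
  · intro x hx
    rw [b.mem_span_image]
    intro k hk
    by_contra hkg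
    exact (Finsupp.mem_support_iff.1 hk) (repr_eq_zero_of_mem_of_ne hc b d hb hx hkg)
  · rw [Submodule.span_le]
    rintro _ ⟨i, rfl, rfl⟩
    exact hb i

variable [CommGroup G]

lemma IsGrading.exists_homogeneous_basis [Finite n] {comp : G → Submodule F A}
    (hc : IsGrading comp) (e : Module.Basis n F A) :
    ∃ (b : Module.Basis n F A) (d : n → G), ∀ i, b i ∈ comp (d i) := by
  classical
  have hint := DirectSum.isInternal_submodule_of_iSupIndep_of_iSup_eq_top hc.1 hc.2.1
  let c := hint.collectedBasis fun g => Module.Basis.ofVectorSpace F (comp g)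
  let σ := c.indexEquiv e
  refine ⟨c.reindex σ, fun i => (σ.symm i).1, fun i => ?_⟩
  rw [Module.Basis.reindex_apply]
  exact hint.collectedBasis_mem _ _

lemma isGrading_span_basis (b : Module.Basis n F A) [SMulCommClass F A A] [IsScalarTower F A A]
    (d : n → G) (hd : ∀ i j k, b.repr (b i * b j) k ≠ 0 → d i * d j = d k) :
    IsGrading fun g => Submodule.span F (b '' (d ⁻¹' {g})) := by
  refine ⟨fun g => ?_, ?_, fun g h x y hx hy => ?_⟩
  · have hdisj : Disjoint (d ⁻¹' {g}) (d ⁻¹' {g}ᶜ) :=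
      (Set.disjoint_left.2 fun _ h h' => h' h)
    refine (b.linearIndependent.disjoint_span_image hdisj).mono_right ?_
    refine iSup₂_le fun j hj => Submodule.span_mono (Set.image_mono ?_)
    rintro i rfl
    exact hj
  · rw [eq_top_iff, ← b.span_eq, Submodule.span_le]
    rintro _ ⟨i, rfl⟩
    exact Submodule.mem_iSup_of_mem (d i) (Submodule.subset_span ⟨i, rfl, rfl⟩)
  · induction hx using Submodule.span_induction with
    | zero => rw [zero_mul]; exact zero_mem _
    | add x x' _ _ hx hx' => rw [add_mul]; exact add_mem hx hx'
    | smul c x _ hx => rw [smul_mul_assoc]; exact Submodule.smul_mem _ _ hx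
    | mem x hx =>
      obtain ⟨i, rfl, rfl⟩ := hx
      induction hy using Submodule.span_induction with
      | zero => rw [mul_zero]; exact zero_mem _
      | add x x' _ _ hx hx' => rw [mul_add]; exact add_mem hx hx'
      | smul c x _ hx => rw [mul_smul_comm]; exact Submodule.smul_mem _ _ hx
      | mem y hy =>
        obtain ⟨j, rfl, rfl⟩ := hy
        rw [b.mem_span_image]
        intro k hk
        exact (hd i j k (Finsupp.mem_support_iff.1 hk)).symm

lemma gradingSupp_span_basis (b : Module.Basis n F A) (d : n → G) :
    gradingSupp (fun g => Submodule.span F (b '' (d ⁻¹' {g}))) = Set.range d := by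
  ext g
  rw [gradingSupp, Set.mem_ofPred_eq, Ne, Submodule.span_eq_bot]
  constructor
  · intro h
    by_contra hg
    refine h ?_
    rintro _ ⟨i, hi, rfl⟩
    exact (hg ⟨i, hi⟩).elim
  · rintro ⟨i, rfl⟩ h
    exact b.ne_zero i (h _ ⟨i, rfl, rfl⟩)

/-- Gradings spanned by bases with the same structure constants, and degrees matched by an
injective map, are equivalent. -/
lemma gradingEquiv_span_basis [Fintype n] [SMulCommClass F A A] [IsScalarTower F A A] {H : Type*}
    [CommGroup H] (b c : Module.Basis n F A)
    (h : ∀ i j k, b.repr (b i * b j) k = c.repr (c i * c j) k) (d : n → G) {α : G → H}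
    (hα : Function.Injective α) :
    GradingEquiv (fun g => Submodule.span F (b '' (d ⁻¹' {g})))
      fun g => Submodule.span F (c '' ((α ∘ d) ⁻¹' {g})) := by
  refine ⟨α, b.equiv c (Equiv.refl n), b.equiv_mul c h, ?_, fun g _ => ?_⟩
  · rw [gradingSupp_span_basis, gradingSupp_span_basis, Set.range_comp]
    exact hα.injOn.bijOn_image
  · rw [Submodule.map_span, ← Set.image_comp]
    congr 1
    have hφ : ((b.equiv c (Equiv.refl n) : A →ₗ[F] A) ∘ b : n → A) = c :=
      funext fun i => by simp
    rw [hφ]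
    congr 1
    ext i
    exact hα.eq_iff.symm

end Grading

/-- Elements of an abelian group may be replaced by elements of a small abelian group. -/
lemma exists_small_commGroup_hom {m : ℕ} {H : Type*} [CommGroup H] (d : Fin m → H) :
    ∃ (G : Type) (_ : CommGroup G) (α : G →* H) (d' : Fin m → G),
      Function.Injective α ∧ α ∘ d' = d := by
  let f : Abelianization (FreeGroup (Fin m)) →* H := Abelianization.lift (FreeGroup.lift d)
  refine ⟨Abelianization (FreeGroup (Fin m)) ⧸ f.ker, inferInstance, QuotientGroup.kerLift f,
    fun i => QuotientGroup.mk (Abelianization.of (FreeGroup.of i)),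
    QuotientGroup.kerLift_injective f, ?_⟩
  ext i
  simp [f]

lemma Module.Basis.repr_apply_eq_sum {n R M : Type*} [Fintype n] [CommRing R] [AddCommGroup M]
    [Module R M] (b c : Module.Basis n R M) (x : M) (k : n) :
    c.repr x k = ∑ l, b.repr x l * c.repr (b l) k := by
  nth_rewrite 1 [← b.sum_repr x]
  rw [map_sum, Finsupp.finsetSum_apply]
  simp only [map_smul, Finsupp.smul_apply, smul_eq_mul]

lemma Module.Basis.baseChange_repr_mul {n F K A : Type*} [CommRing F] [CommRing K]
    [Algebra F K] [NonUnitalNonAssocRing A] [Module F A] [SMulCommClass F A A]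
    [IsScalarTower F A A] (b : Module.Basis n F A) (i j k : n) :
    (b.baseChange K).repr (b.baseChange K i * b.baseChange K j) k =
      algebraMap F K (b.repr (b i * b j) k) := by
  rw [Module.Basis.baseChange_apply, Module.Basis.baseChange_apply, Algebra.TensorProduct.tmul_mul_tmul, mul_one,
    Module.Basis.baseChange_repr_tmul, Algebra.algebraMap_eq_smul_one]

lemma Module.Basis.toMatrix_transpose_mul_toMatrix_transpose {n R M : Type*} [Fintype n]
    [DecidableEq n] [CommRing R] [AddCommGroup M] [Module R M] (b c : Module.Basis n R M) :
    (b.toMatrix c).transpose * (c.toMatrix b).transpose = 1 := by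
  rw [← Matrix.transpose_mul, Module.Basis.toMatrix_mul_toMatrix_flip, Matrix.transpose_one]

lemma Module.Basis.exists_basis_eq_sum_smul {n R M : Type*} [Fintype n] [DecidableEq n]
    [CommRing R] [AddCommGroup M] [Module R M] (b : Module.Basis n R M) {P Q : Matrix n n R}
    (h : P * Q = 1) : ∃ c : Module.Basis n R M, ∀ i, c i = ∑ j, P i j • b j := by
  have h1 : P.transpose * Q.transpose = 1 := by
    rw [← Matrix.transpose_mul, mul_eq_one_comm.1 h, Matrix.transpose_one]
  refine ⟨b.map (Matrix.toLinOfInv b b h1 (mul_eq_one_comm.1 h1)), fun i => ?_⟩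
  rw [Module.Basis.map_apply, Matrix.toLinOfInv_apply, Matrix.toLin_self]
  rfl

/-- A homogeneous basis of an algebra with an `F`-form can be changed to one whose structure
constants lie in `F`. -/
lemma Module.Basis.exists_homogeneous_basis_repr_mul_mem_range {n F K A H : Type*} [Fintype n]
    [DecidableEq n] [Field F] [IsAlgClosed F] [CharZero F] [Field K] [IsAlgClosed K] [Algebra F K]
    [NonUnitalNonAssocRing A] [Module K A] [SMulCommClass K A A] [IsScalarTower K A A]
    [CommGroup H] [DecidableEq H] (p e : Module.Basis n K A) (a : n → n → n → F)
    (ha : (fun i j k => e.repr (e i * e j) k) = fun i j k => algebraMap F K (a i j k))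
    (d : n → H) (hd : ∀ i j k, d i * d j ≠ d k → p.repr (p i * p j) k = 0) :
    ∃ (u : Module.Basis n K A) (y : n → n → n → F),
      (∀ i, u i ∈ Submodule.span K (p '' (d ⁻¹' {d i}))) ∧
      ∀ i j k, u.repr (u i * u j) k = algebraMap F K (y i j k) := by
  obtain ⟨h, g, y, hg, hhd, hy⟩ := exists_homogeneous_basis_structureConstants_descend d
    (fun i j k => p.repr (p i * p j) k) fun D =>
      D.apply_graded_structureConstants d a _ hd
        (e.toMatrix_transpose_mul_toMatrix_transpose p) fun i j k => by
          rw [← ha]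
          exact (e.repr_mul (p i) (p j) k).symm.trans (p.repr_apply_eq_sum e _ k)
  obtain ⟨u, hu⟩ := p.exists_basis_eq_sum_smul hg
  refine ⟨u, y, fun i => ?_, fun i j k => ?_⟩
  · rw [hu]
    refine sum_mem fun j _ => ?_
    by_cases hij : d i = d j
    · exact Submodule.smul_mem _ _ (Submodule.subset_span ⟨j, hij.symm, rfl⟩)
    · rw [hhd i j hij, zero_smul]
      exact zero_mem _
  · have : u i * u j = ∑ l, algebraMap F K (y i j l) • u l := by
      simp only [hu]
      rw [p.sum_smul_mul_sum_smul]
      refine (Finset.sum_congr rfl fun k _ => congrArg (· • p k) (hy i j k)).trans ?_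
      simp only [Finset.sum_smul, Finset.smul_sum, smul_smul]
      exact Finset.sum_comm
    rw [this, u.repr_sum_self]

/-- every grading on `A_K` is equivalent to the scalar extension of some
grading on `A`. -/
theorem grading_descends_up_to_equiv
    {F : Type*} [Field F] [IsAlgClosed F] [CharZero F]
    {K : Type*} [Field K] [Algebra F K] [IsAlgClosed K]
    {A : Type*} [NonUnitalNonAssocRing A] [Module F A]
    [SMulCommClass F A A] [IsScalarTower F A A] [FiniteDimensional F A]
    {H : Type*} [CommGroup H]
    (Δ : H → Submodule K (K ⊗[F] A)) (hΔ : IsGrading Δ) :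
    ∃ (G : Type) (_ : CommGroup G) (comp : G → Submodule F A),
      IsGrading comp ∧
        GradingEquiv (fun g : G => (comp g).baseChange K) Δ := by
  classical
  let e := Module.finBasis F A
  let a := fun i j k => e.repr (e i * e j) k
  let eK := e.baseChange K
  have ha : (fun i j k => eK.repr (eK i * eK j) k) = fun i j k => algebraMap F K (a i j k) :=
    funext fun i => funext fun j => funext fun k => e.baseChange_repr_mul i j k
  obtain ⟨p, d, hp⟩ := hΔ.exists_homogeneous_basis eK
  obtain ⟨u, y, hu, huy⟩ := p.exists_homogeneous_basis_repr_mul_mem_range eK a ha d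
    fun i j k h => repr_eq_zero_of_mem_of_ne hΔ.1 p d hp (hΔ.2.2 _ _ _ _ (hp i) (hp j)) h.symm
  have huΔ : ∀ i, u i ∈ Δ (d i) := fun i => by
    rw [eq_span_of_homogeneous_basis hΔ.1 p d hp]
    exact hu i
  obtain ⟨P, Q, hPQ, hP⟩ := exists_matrix_structureMul_descend a y
    (eK.toMatrix_transpose_mul_toMatrix_transpose u) fun i j k => by
      rw [← ha]
      refine (eK.repr_mul (u i) (u j) k).symm.trans ((u.repr_apply_eq_sum eK _ k).trans ?_)
      simp only [huy]
      rfl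
  obtain ⟨b, hb⟩ := e.exists_basis_eq_sum_smul hPQ
  have hby : ∀ i j k, b.repr (b i * b j) k = y i j k := by
    intro i j k
    have : b i * b j = ∑ l, y i j l • b l := by
      simp only [hb]
      rw [e.sum_smul_mul_sum_smul]
      refine (Finset.sum_congr rfl fun k _ => congrArg (· • e k) (hP i j k)).trans ?_
      simp only [Finset.sum_smul, Finset.smul_sum, smul_smul]
      exact Finset.sum_comm
    rw [this, b.repr_sum_self]
  have hbu : ∀ i j k, (b.baseChange K).repr (b.baseChange K i * b.baseChange K j) k =
      u.repr (u i * u j) k := fun i j k => by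
    rw [b.baseChange_repr_mul, hby, huy]
  obtain ⟨G, _, α, d', hα, rfl⟩ := exists_small_commGroup_hom d
  refine ⟨G, inferInstance, _, isGrading_span_basis b d' fun i j k h => hα ?_, ?_⟩
  · by_contra hne
    refine h ?_
    rw [hby]
    apply (algebraMap F K).injective
    rw [← huy, map_zero]
    refine repr_eq_zero_of_mem_of_ne hΔ.1 u _ huΔ (hΔ.2.2 _ _ _ _ (huΔ i) (huΔ j)) ?_
    rw [map_mul] at hne
    exact fun h => hne h.symm
  · have h1 := gradingEquiv_span_basis (b.baseChange K) u hbu d' hα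
    have h2 : Δ = fun g => Submodule.span K (u '' ((α ∘ d') ⁻¹' {g})) :=
      funext fun g => eq_span_of_homogeneous_basis hΔ.1 u _ huΔ g
    have h3 : ∀ g, (Submodule.span F (b '' (d' ⁻¹' {g}))).baseChange K =
        Submodule.span K (b.baseChange K '' (d' ⁻¹' {g})) := fun g => by
      rw [Submodule.baseChange_span, ← Set.image_comp]
      congr 2
      ext i
      simp
    rw [h2, funext h3]
    exact h1
end
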